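/- Fix an integer r ≥ 1 and take the constant interaction range r_n = r for all n. Then, under the law μ_n, the rescaled magnetization S_n/√n converges in distribution to the centered Gaussian law N(0, σ_r²), where σ_r > 0 is the unique positive real number satisfying ∫_0^1 (1/σ_r² + 1 − (1/r) Σ_{m=1}^r cos(2πmt))^{−1} dt = 1. -/

import Mathlib

open MeasureTheory ProbabilityTheory Real Filter Topology

noncomputable section

/-- The Hamiltonian of the model: each spin interacts with its `2r` nearest
neighbours on the discrete circle `ℤ/nℤ`. -/
def Ham (n r : ℕ) (x : Fin n → ℝ) : ℝ :=
  -(1 / (2 * (r : ℝ))) *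
    ∑ i : Fin n, ∑ j ∈ Finset.Icc 1 r, x i * x ⟨((i : ℕ) + j) % n, Nat.mod_lt _ i.pos⟩

/-- The self-adjusted temperature. -/
def Temp (n : ℕ) (x : Fin n → ℝ) : ℝ := (∑ i : Fin n, (x i) ^ 2) / n

/-- The magnetization. -/
def Mag (n : ℕ) (x : Fin n → ℝ) : ℝ := ∑ i : Fin n, x i

/-- The unnormalized measure `exp(-H_n/T_n) 1_{T_n>0} dν^{⊗n}`. -/
def preμ (n r : ℕ) : Measure (Fin n → ℝ) :=
  (Measure.pi fun _ : Fin n => (gaussianReal 0 1 : Measure ℝ)).withDensity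
    fun x => if 0 < Temp n x then ENNReal.ofReal (Real.exp (-(Ham n r x) / Temp n x)) else 0

/-- The probability measure `μ_n` of the model. -/
def μmeas (n r : ℕ) : Measure (Fin n → ℝ) := (preμ n r Set.univ)⁻¹ • preμ n r

lemma lintegral_Ioi_comp_mul_left {c : ℝ} (hc : 0 < c) (f : ℝ → ENNReal) (hf : Measurable f) :
    ∫⁻ t in Set.Ioi (0 : ℝ), f (c * t) = ENNReal.ofReal c⁻¹ * ∫⁻ t in Set.Ioi (0 : ℝ), f t := by
  have h := Real.map_volume_mul_left hc.ne'
  rw [← abs_of_pos (inv_pos.2 hc), ← smul_eq_mul, ← lintegral_smul_measure, ← Measure.restrict_smul,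
    ← h, setLIntegral_map measurableSet_Ioi hf (measurable_const_mul c)]
  congr 2
  ext t
  simp [hc]

lemma lintegral_eq_lintegral_sphere {ι : Type*} [Fintype ι] [Nonempty ι]
    (F : (ι → ℝ) → ENNReal) (hF : Measurable F) :
    ∫⁻ x, F x = ∫⁻ u, (∫⁻ t in Set.Ioi (0 : ℝ),
      ENNReal.ofReal (t ^ (Fintype.card ι - 1)) * F (t • (u : ι → ℝ)))
        ∂(volume : Measure (ι → ℝ)).toSphere := by
  have key := (volume : Measure (ι → ℝ)).measurePreserving_homeomorphUnitSphereProd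
  have hm : Measurable fun p : Metric.sphere (0 : ι → ℝ) 1 × Set.Ioi (0 : ℝ) =>
      F ((p.2 : ℝ) • (p.1 : ι → ℝ)) := by
    apply hF.comp
    fun_prop
  have h1 : ∫⁻ x, F x = ∫⁻ x : ({0}ᶜ : Set (ι → ℝ)), F x ∂(volume.comap Subtype.val) := by
    rw [lintegral_subtype_comap (measurableSet_singleton _).compl, restrict_compl_singleton]
  have h2 := key.lintegral_comp_emb (Homeomorph.measurableEmbedding _)
    (fun p => F ((p.2 : ℝ) • (p.1 : ι → ℝ)))
  rw [h1]
  calc _ = _ := lintegral_congr fun x => ?_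
    _ = _ := h2
    _ = _ := by
      rw [lintegral_prod _ hm.aemeasurable]
      refine lintegral_congr fun u => ?_
      rw [Measure.volumeIoiPow, lintegral_withDensity_eq_lintegral_mul _ (by fun_prop)
        (by exact hm.comp measurable_prodMk_left)]
      rw [← lintegral_subtype_comap measurableSet_Ioi]
      simp
  have hx : ‖(x : ι → ℝ)‖ ≠ 0 := norm_ne_zero_iff.2 x.2
  simp only [homeomorphUnitSphereProd_apply_snd_coe, homeomorphUnitSphereProd_apply_fst_coe]
  rw [smul_smul, mul_inv_cancel₀ hx, one_smul]

/-- Radial change of variables: multiplication by a positively homogeneous function `c` of degree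
zero. -/
lemma lintegral_comp_radial_smul {ι : Type*} [Fintype ι] [Nonempty ι]
    (c : (ι → ℝ) → ℝ) (hc : Measurable c) (hpos : ∀ x, x ≠ 0 → 0 < c x)
    (hhom : ∀ t : ℝ, 0 < t → ∀ x, c (t • x) = c x)
    (F : (ι → ℝ) → ENNReal) (hF : Measurable F) :
    ∫⁻ x, ENNReal.ofReal (c x ^ Fintype.card ι) * F (c x • x) = ∫⁻ x, F x := by
  have hm : Measurable fun x => F (c x • x) := hF.comp (hc.smul measurable_id)
  rw [lintegral_eq_lintegral_sphere _ (by fun_prop), lintegral_eq_lintegral_sphere F hF]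
  refine lintegral_congr fun u => ?_
  have hu : (u : ι → ℝ) ≠ 0 := ne_zero_of_mem_unit_sphere u
  have hcu := hpos u hu
  set a := c u with ha
  obtain ⟨k, hk⟩ : ∃ k, Fintype.card ι = k + 1 := Nat.exists_eq_succ_of_ne_zero Fintype.card_ne_zero
  have hG : Measurable fun t : ℝ => ENNReal.ofReal (t ^ k) * F (t • (u : ι → ℝ)) := by
    have : Measurable fun t : ℝ => F (t • (u : ι → ℝ)) := hF.comp (by fun_prop)
    fun_prop
  have h := lintegral_Ioi_comp_mul_left hcu _ hG
  rw [hk, Nat.add_sub_cancel]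
  calc _ = ∫⁻ t in Set.Ioi (0 : ℝ), ENNReal.ofReal a *
        (ENNReal.ofReal ((a * t) ^ k) * F ((a * t) • (u : ι → ℝ))) := by
        refine setLIntegral_congr_fun measurableSet_Ioi fun t ht => ?_
        have ht : 0 < t := ht
        rw [hhom t ht, ← ha, smul_smul, ← mul_assoc, ← mul_assoc, ← ENNReal.ofReal_mul (by positivity),
          ← ENNReal.ofReal_mul (by positivity)]
        congr 2
        ring
    _ = _ := by
        rw [lintegral_const_mul _ (by exact hG.comp (measurable_const_mul a)), h, ← mul_assoc,
          ← ENNReal.ofReal_mul hcu.le, mul_inv_cancel₀ hcu.ne', ENNReal.ofReal_one, one_mul]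

lemma pi_gaussianReal_eq_withDensity {ι : Type*} [Fintype ι] :
    (Measure.pi fun _ : ι => gaussianReal 0 1) =
      (volume : Measure (ι → ℝ)).withDensity fun x =>
        ENNReal.ofReal ((√(2 * π))⁻¹ ^ Fintype.card ι * rexp (-(∑ i, x i ^ 2) / 2)) := by
  have hprod : ∀ x : ι → ℝ, (√(2 * π))⁻¹ ^ Fintype.card ι * rexp (-(∑ i, x i ^ 2) / 2) =
      ∏ i, gaussianPDFReal 0 1 (x i) := by
    intro x
    simp only [gaussianPDFReal, NNReal.coe_one, mul_one, sub_zero, Finset.prod_mul_distrib,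
      Finset.prod_const, Finset.card_univ, ← Real.exp_sum, ← Finset.sum_div, Finset.sum_neg_distrib]
  simp_rw [hprod]
  refine Measure.pi_eq fun s hs => ?_
  rw [withDensity_apply _ (MeasurableSet.univ_pi hs)]
  have hint : Integrable (fun x : ι → ℝ => ∏ i, (s i).indicator (gaussianPDFReal 0 1) (x i)) :=
    Integrable.fintype_prod_dep fun i => (integrable_gaussianPDFReal 0 1).indicator (hs i)
  have hind : ∀ (i : ι) (t : ℝ), 0 ≤ (s i).indicator (gaussianPDFReal 0 1) t := fun i t =>
    Set.indicator_nonneg (fun _ _ => gaussianPDFReal_nonneg _ _ _) t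
  calc _ = ∫⁻ x : ι → ℝ, ENNReal.ofReal (∏ i, (s i).indicator (gaussianPDFReal 0 1) (x i)) := by
        rw [← lintegral_indicator (MeasurableSet.univ_pi hs)]
        refine lintegral_congr fun x => ?_
        by_cases hx : x ∈ Set.univ.pi s
        · rw [Set.indicator_of_mem hx]
          congr 1
          refine Finset.prod_congr rfl fun i _ => ?_
          rw [Set.indicator_of_mem (hx i trivial)]
        · rw [Set.indicator_of_notMem hx]
          simp only [Set.mem_univ_pi, not_forall] at hx
          obtain ⟨i, hi⟩ := hx
          rw [Finset.prod_eq_zero (Finset.mem_univ i) (Set.indicator_of_notMem hi _),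
            ENNReal.ofReal_zero]
    _ = ∏ i, ENNReal.ofReal (∫ t, (s i).indicator (gaussianPDFReal 0 1) t) := by
        rw [← ofReal_integral_eq_lintegral_ofReal hint
          (Eventually.of_forall fun x => Finset.prod_nonneg fun i _ => hind i _),
          integral_fintype_prod_volume_eq_prod
            (f := fun i => (s i).indicator (gaussianPDFReal 0 1)), ENNReal.ofReal_prod_of_nonneg
              fun i _ => integral_nonneg (hind i)]
    _ = _ := by
        refine Finset.prod_congr rfl fun i _ => ?_
        rw [gaussianReal_apply_eq_integral _ one_ne_zero, integral_indicator (hs i)]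

lemma sum_cexp_eq_zero {n : ℕ} {m : ℤ} (hm : ¬ (n : ℤ) ∣ m) :
    ∑ i : Fin n, Complex.exp ((2 * π * m * (i : ℕ) / n : ℝ) * Complex.I) = 0 := by
  rcases Nat.eq_zero_or_pos n with rfl | hn
  · simp
  have hn0 : (n : ℂ) ≠ 0 := by exact_mod_cast hn.ne'
  set z := Complex.exp (2 * π * Complex.I * m / n) with hz
  have hz1 : z ≠ 1 := by
    intro h
    obtain ⟨q, hq⟩ := Complex.exp_eq_one_iff.1 h
    apply hm
    refine ⟨q, ?_⟩
    have h2 : (m : ℂ) = n * q := by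
      have := Complex.two_pi_I_ne_zero
      field_simp at hq
      linear_combination hq
    exact_mod_cast h2
  have hzn : z ^ n = 1 := by
    rw [hz, ← Complex.exp_nat_mul, Complex.exp_eq_one_iff]
    exact ⟨m, by field_simp⟩
  have hterm : ∀ i : ℕ, Complex.exp ((2 * π * m * i / n : ℝ) * Complex.I) = z ^ i := by
    intro i
    rw [hz, ← Complex.exp_nat_mul]
    congr 1
    push_cast
    ring
  simp_rw [hterm]
  rw [Fin.sum_univ_eq_sum_range (fun i => z ^ i) n, geom_sum_eq hz1, hzn, sub_self, zero_div]

lemma sum_cos_eq_zero {n : ℕ} {m : ℤ} (hm : ¬ (n : ℤ) ∣ m) :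
    ∑ i : Fin n, Real.cos (2 * π * m * (i : ℕ) / n) = 0 := by
  have h := congrArg Complex.re (sum_cexp_eq_zero hm)
  simpa only [Complex.re_sum, Complex.exp_ofReal_mul_I_re, Complex.zero_re] using h

lemma sum_sin_eq_zero {n : ℕ} (m : ℤ) :
    ∑ i : Fin n, Real.sin (2 * π * m * (i : ℕ) / n) = 0 := by
  by_cases hm : (n : ℤ) ∣ m
  · obtain ⟨q, rfl⟩ := hm
    refine Finset.sum_eq_zero fun i _ => ?_
    have hn : (n : ℝ) ≠ 0 := by exact_mod_cast i.pos.ne'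
    rw [show 2 * π * ((n * q : ℤ) : ℝ) * (i : ℕ) / n = ((2 * q * (i : ℕ) : ℤ) : ℝ) * π by
      push_cast; field_simp]
    exact Real.sin_int_mul_pi _
  · have h := congrArg Complex.im (sum_cexp_eq_zero hm)
    simpa only [Complex.im_sum, Complex.exp_ofReal_mul_I_im, Complex.zero_im] using h

/-- The discrete Hartley kernel, a real orthogonal matrix diagonalizing symmetric circulants. -/
def hartley (n : ℕ) (k : Fin n) (i : ℕ) : ℝ :=
  (Real.cos (2 * π * (k : ℕ) * i / n) + Real.sin (2 * π * (k : ℕ) * i / n)) / √n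

lemma hartley_mod {n : ℕ} (k : Fin n) (i : ℕ) : hartley n k (i % n) = hartley n k i := by
  have hn : (n : ℝ) ≠ 0 := by exact_mod_cast k.pos.ne'
  have h : 2 * π * (k : ℕ) * i / n = 2 * π * (k : ℕ) * (i % n : ℕ) / n
      + ((k * (i / n) : ℕ) : ℝ) * (2 * π) := by
    have := Nat.mod_add_div i n
    have h2 : (i : ℝ) = (i % n : ℕ) + n * (i / n : ℕ) := by exact_mod_cast this.symm
    rw [h2]
    push_cast
    field_simp
  unfold hartley
  rw [h, Real.cos_add_nat_mul_two_pi, Real.sin_add_nat_mul_two_pi]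

lemma hartley_add_add_hartley {n : ℕ} (k : Fin n) (i j : ℕ) :
    hartley n k (i + j + j) + hartley n k i =
      2 * Real.cos (2 * π * (k : ℕ) * j / n) * hartley n k (i + j) := by
  unfold hartley
  have h1 : 2 * π * (k : ℕ) * (i + j + j : ℕ) / n =
      2 * π * (k : ℕ) * (i + j : ℕ) / n + 2 * π * (k : ℕ) * j / n := by push_cast; ring
  have h2 : 2 * π * (k : ℕ) * i / n =
      2 * π * (k : ℕ) * (i + j : ℕ) / n - 2 * π * (k : ℕ) * j / n := by push_cast; ring
  rw [h1, h2, Real.cos_add, Real.sin_add, Real.cos_sub, Real.sin_sub]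
  ring

lemma sum_hartley_mul_hartley {n : ℕ} (k l : Fin n) :
    ∑ i : Fin n, hartley n k i * hartley n l i = if k = l then 1 else 0 := by
  have hn : (0 : ℝ) < n := by exact_mod_cast k.pos
  have hterm : ∀ i : Fin n, hartley n k i * hartley n l i =
      (Real.cos (2 * π * ((k : ℤ) - (l : ℤ) : ℤ) * (i : ℕ) / n) +
        Real.sin (2 * π * ((k : ℤ) + (l : ℤ) : ℤ) * (i : ℕ) / n)) / n := by
    intro i
    have h1 : 2 * π * ((k : ℤ) - (l : ℤ) : ℤ) * (i : ℕ) / n =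
        2 * π * (k : ℕ) * (i : ℕ) / n - 2 * π * (l : ℕ) * (i : ℕ) / n := by push_cast; ring
    have h2 : 2 * π * ((k : ℤ) + (l : ℤ) : ℤ) * (i : ℕ) / n =
        2 * π * (k : ℕ) * (i : ℕ) / n + 2 * π * (l : ℕ) * (i : ℕ) / n := by push_cast; ring
    unfold hartley
    rw [h1, h2, Real.cos_sub, Real.sin_add, div_mul_div_comm, Real.mul_self_sqrt hn.le]
    ring
  simp_rw [hterm]
  rw [← Finset.sum_div, Finset.sum_add_distrib, sum_sin_eq_zero, add_zero]
  split_ifs with h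
  · subst h
    simp [hn.ne']
  · rw [sum_cos_eq_zero, zero_div]
    intro hd
    apply h
    have := Int.eq_zero_of_abs_lt_dvd hd (by rw [abs_lt]; omega)
    ext
    omega

lemma sum_hartley_transform_mul {n : ℕ} (y z : Fin n → ℝ) :
    ∑ i : Fin n, (∑ k, hartley n k i * y k) * (∑ k, hartley n k i * z k) = ∑ k, y k * z k := by
  have h : ∀ i : Fin n, (∑ k, hartley n k i * y k) * (∑ k, hartley n k i * z k) =
      ∑ k, ∑ l, (hartley n k i * hartley n l i) * (y k * z l) := by
    intro i
    rw [Finset.sum_mul_sum]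
    exact Finset.sum_congr rfl fun k _ => Finset.sum_congr rfl fun l _ => by ring
  simp_rw [h]
  rw [Finset.sum_comm]
  refine Finset.sum_congr rfl fun k _ => ?_
  rw [Finset.sum_comm]
  simp_rw [← Finset.sum_mul, sum_hartley_mul_hartley]
  simp

lemma sum_hartley_transform {n : ℕ} [NeZero n] (z : Fin n → ℝ) :
    ∑ i : Fin n, ∑ k, hartley n k i * z k = √(n : ℝ) * z 0 := by
  have h := sum_hartley_transform_mul (Pi.single 0 1) z
  have hs : √(n : ℝ) ≠ 0 := (Real.sqrt_pos.2 (by exact_mod_cast NeZero.pos n)).ne'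
  simp only [Pi.single_apply, mul_ite, mul_one, mul_zero, Finset.sum_ite_eq', Finset.mem_univ,
    if_true, ite_mul, one_mul, zero_mul] at h
  rw [← h, Finset.mul_sum]
  refine Finset.sum_congr rfl fun i _ => ?_
  have h0 : hartley n 0 i = 1 / √(n : ℝ) := by simp [hartley]
  rw [h0, ← mul_assoc, mul_one_div_cancel hs, one_mul]

lemma sum_hartley_transform_mul_shift {n : ℕ} (z : Fin n → ℝ) (j : ℕ) :
    ∑ i : Fin n, (∑ k, hartley n k i * z k) * (∑ k, hartley n k (((i : ℕ) + j) % n) * z k) =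
      ∑ k : Fin n, Real.cos (2 * π * (k : ℕ) * j / n) * z k ^ 2 := by
  rcases Nat.eq_zero_or_pos n with rfl | hn
  · simp
  have : NeZero n := ⟨hn.ne'⟩
  set x : Fin n → ℝ := fun i => ∑ k, hartley n k i * z k with hx
  let e : Fin n ≃ Fin n := Equiv.addRight (Fin.ofNat n j)
  have he : ∀ i : Fin n, ((e i : Fin n) : ℕ) = ((i : ℕ) + j) % n := by
    intro i
    simp [e, Fin.val_add, Fin.ofNat]
  have hxe : ∀ i : Fin n, (∑ k, hartley n k (((i : ℕ) + j) % n) * z k) = x (e i) := by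
    intro i
    simp [hx, he]
  have hrec : ∀ i, x (e (e i)) + x i =
      ∑ k, hartley n k (e i : Fin n) * (2 * Real.cos (2 * π * (k : ℕ) * j / n) * z k) := by
    intro i
    simp only [hx, ← Finset.sum_add_distrib]
    refine Finset.sum_congr rfl fun k _ => ?_
    have h := hartley_add_add_hartley k i j
    have h1 : hartley n k (e (e i) : Fin n) = hartley n k (i + j + j) := by
      rw [he, he, Nat.mod_add_mod, hartley_mod]
    have h2 : hartley n k (e i : Fin n) = hartley n k (i + j) := by rw [he, hartley_mod]
    rw [h1, h2, ← add_mul, h]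
    ring
  have hs : ∑ i, x (e i) * (x (e (e i)) + x i) = 2 * ∑ i, x i * x (e i) := by
    simp_rw [mul_add]
    rw [Finset.sum_add_distrib, Equiv.sum_comp e fun i => x i * x (e i), two_mul]
    congr 1
    exact Finset.sum_congr rfl fun i _ => mul_comm _ _
  have hs2 : ∑ i, x (e i) * (x (e (e i)) + x i) =
      ∑ k : Fin n, z k * (2 * Real.cos (2 * π * (k : ℕ) * j / n) * z k) := by
    simp_rw [hrec]
    rw [Equiv.sum_comp e fun i => x i *
      ∑ k, hartley n k i * (2 * Real.cos (2 * π * (k : ℕ) * j / n) * z k)]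
    exact sum_hartley_transform_mul z _
  simp_rw [hxe]
  have h3 : 2 * ∑ i, x i * x (e i) =
      2 * ∑ k : Fin n, Real.cos (2 * π * (k : ℕ) * j / n) * z k ^ 2 := by
    rw [← hs, hs2, Finset.mul_sum]
    exact Finset.sum_congr rfl fun k _ => by ring
  linarith

/-- The eigenvalue of the interaction at frequency `t`. -/
def dispersion (r : ℕ) (t : ℝ) : ℝ :=
  (1 / (r : ℝ)) * ∑ m ∈ Finset.Icc 1 r, Real.cos (2 * π * m * t)

lemma Ham_hartley_transform (n r : ℕ) (z : Fin n → ℝ) :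
    Ham n r (fun i => ∑ k, hartley n k i * z k) =
      -(∑ k : Fin n, dispersion r ((k : ℕ) / n) * z k ^ 2) / 2 := by
  unfold Ham
  rw [Finset.sum_comm]
  simp_rw [sum_hartley_transform_mul_shift, dispersion]
  rw [Finset.sum_comm, neg_mul, neg_div, Finset.mul_sum, Finset.sum_div]
  congr 1
  refine Finset.sum_congr rfl fun k _ => ?_
  rw [← Finset.sum_mul]
  have : ∀ m : ℕ, 2 * π * (k : ℕ) * m / n = 2 * π * m * ((k : ℕ) / n) := fun m => by ring
  simp_rw [this]
  ring

lemma exists_lintegral_hartley_transform {n : ℕ} (b : Fin n → ℝ) (hb : ∀ k, b k ≠ 0) :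
    ∃ C : ENNReal, C ≠ 0 ∧ C ≠ ⊤ ∧ ∀ F : (Fin n → ℝ) → ENNReal, Measurable F →
      ∫⁻ x, F x = C * ∫⁻ g : Fin n → ℝ, F (fun i => ∑ k, hartley n k i * (b k * g k)) := by
  let P : Matrix (Fin n) (Fin n) ℝ := Matrix.of fun i k => hartley n k i
  let M : Matrix (Fin n) (Fin n) ℝ := P * Matrix.diagonal b
  have hP : P.transpose * P = 1 := by
    ext k l
    simp only [Matrix.mul_apply, P, Matrix.transpose_apply, Matrix.of_apply, Matrix.one_apply]
    exact sum_hartley_mul_hartley k l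
  have hM : M.det ≠ 0 := by
    rw [Matrix.det_mul, Matrix.det_diagonal]
    exact mul_ne_zero (Matrix.det_ne_zero_of_left_inverse hP) (Finset.prod_ne_zero_iff.2 fun k _ => hb k)
  have hMg : ∀ g, Matrix.toLin' M g = fun i : Fin n => ∑ k, hartley n k i * (b k * g k) := by
    intro g
    ext i
    simp only [M, P, Matrix.toLin'_apply, Matrix.mulVec, dotProduct, Matrix.mul_diagonal, Matrix.of_apply, mul_assoc]
  have hc : (0 : ℝ) < |(M.det)⁻¹| := abs_pos.2 (inv_ne_zero hM)
  refine ⟨(ENNReal.ofReal |(M.det)⁻¹|)⁻¹, ENNReal.inv_ne_zero.2 ENNReal.ofReal_ne_top,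
    ENNReal.inv_ne_top.2 (ENNReal.ofReal_pos.2 hc).ne', fun F hF => ?_⟩
  have h := Real.map_matrix_volume_pi_eq_smul_volume_pi hM
  have hmeas : Measurable (Matrix.toLin' M) :=
    (LinearMap.continuous_of_finiteDimensional (Matrix.toLin' M)).measurable
  have h2 : ∫⁻ g, F (Matrix.toLin' M g) = ENNReal.ofReal |(M.det)⁻¹| * ∫⁻ x, F x := by
    rw [← lintegral_map hF hmeas, h, lintegral_smul_measure, smul_eq_mul]
  simp_rw [← hMg]
  rw [h2, ← mul_assoc, ENNReal.inv_mul_cancel (ENNReal.ofReal_pos.2 hc).ne' ENNReal.ofReal_ne_top,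
    one_mul]

/-- The squared Euclidean norm of `g` relative to the one weighted by `a`. -/
def normRatio {n : ℕ} (a g : Fin n → ℝ) : ℝ := (∑ k, g k ^ 2) / ∑ k, a k * g k ^ 2

/-- The density relating the Gibbs measure to a Gaussian one with covariance `a`. -/
def gibbsWeight {n : ℕ} (a g : Fin n → ℝ) : ℝ :=
  rexp (-(n / 2) * (normRatio a g - 1 - Real.log (normRatio a g)))

lemma measurable_normRatio {n : ℕ} (a : Fin n → ℝ) : Measurable (normRatio a) := by
  unfold normRatio
  fun_prop

lemma measurable_gibbsWeight {n : ℕ} (a : Fin n → ℝ) : Measurable (gibbsWeight a) := by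
  have := measurable_normRatio a
  unfold gibbsWeight
  fun_prop

lemma sum_sq_pos {n : ℕ} {g : Fin n → ℝ} (hg : g ≠ 0) : 0 < ∑ k, g k ^ 2 := by
  obtain ⟨k, hk⟩ := Function.ne_iff.1 hg
  exact Finset.sum_pos' (fun i _ => sq_nonneg _) ⟨k, Finset.mem_univ k, by
    have : g k ≠ 0 := hk
    positivity⟩

lemma weighted_sum_sq_pos {n : ℕ} {a g : Fin n → ℝ} (ha : ∀ k, 0 < a k) (hg : g ≠ 0) :
    0 < ∑ k, a k * g k ^ 2 := by
  obtain ⟨k, hk⟩ := Function.ne_iff.1 hg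
  exact Finset.sum_pos' (fun i _ => mul_nonneg (ha i).le (sq_nonneg _)) ⟨k, Finset.mem_univ k, by
    have : g k ≠ 0 := hk
    have := ha k
    positivity⟩

lemma normRatio_pos {n : ℕ} {a g : Fin n → ℝ} (ha : ∀ k, 0 < a k) (hg : g ≠ 0) :
    0 < normRatio a g :=
  div_pos (sum_sq_pos hg) (weighted_sum_sq_pos ha hg)

lemma measurable_Temp (n : ℕ) : Measurable (Temp n) := by
  unfold Temp
  fun_prop

lemma measurable_Ham (n r : ℕ) : Measurable (Ham n r) := by
  unfold Ham
  fun_prop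

lemma measurable_Mag (n : ℕ) : Measurable (Mag n) := by
  unfold Mag
  fun_prop

/-- The law of the magnetization under the Gibbs measure, in terms of independent Gaussians. -/
lemma exists_lintegral_preμ {n r : ℕ} [NeZero n] {s : ℝ} {a : Fin n → ℝ} (ha : ∀ k, 0 < a k)
    (has : ∀ k : Fin n, dispersion r ((k : ℕ) / n) * a k = s * a k - 1) :
    ∃ C : ENNReal, C ≠ 0 ∧ C ≠ ⊤ ∧ ∀ f : ℝ → ENNReal, Measurable f →
      ∫⁻ x, f (Mag n x / √(n : ℝ)) ∂(preμ n r) =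
        C * ∫⁻ g, ENNReal.ofReal (gibbsWeight a g) * f (√(normRatio a g) * (√(a 0) * g 0))
          ∂(Measure.pi fun _ : Fin n => gaussianReal 0 1) := by
  obtain ⟨C, hC0, hCt, hC⟩ := exists_lintegral_hartley_transform (fun k => √(a k))
    fun k => (Real.sqrt_pos.2 (ha k)).ne'
  have hnpos : (0 : ℝ) < n := by exact_mod_cast NeZero.pos n
  set E := ENNReal.ofReal (rexp (n / 2 * (s - 1))) with hE
  refine ⟨C * E, mul_ne_zero hC0 (ENNReal.ofReal_pos.2 (Real.exp_pos _)).ne',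
    ENNReal.mul_ne_top hCt ENNReal.ofReal_ne_top, fun f hf => ?_⟩
  set p : (Fin n → ℝ) → ENNReal := fun x =>
    ENNReal.ofReal ((√(2 * π))⁻¹ ^ Fintype.card (Fin n) * rexp (-(∑ i, x i ^ 2) / 2)) with hp
  have hpm : Measurable p := by fun_prop
  set d : (Fin n → ℝ) → ENNReal := fun x =>
    if 0 < Temp n x then ENNReal.ofReal (Real.exp (-(Ham n r x) / Temp n x)) else 0 with hd
  have hT := measurable_Temp n
  have hH := measurable_Ham n r
  have hMg := measurable_Mag n
  have hdm : Measurable d :=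
    Measurable.ite (measurableSet_lt measurable_const hT) (by fun_prop) measurable_const
  have hW := measurable_gibbsWeight a
  have hR := measurable_normRatio a
  have hfM : Measurable fun x => f (Mag n x / √(n : ℝ)) := hf.comp (by fun_prop)
  have hfR : Measurable fun g => f (√(normRatio a g) * (√(a 0) * g 0)) := hf.comp (by fun_prop)
  have hWf : Measurable fun g =>
      ENNReal.ofReal (gibbsWeight a g) * f (√(normRatio a g) * (√(a 0) * g 0)) := by fun_prop
  let K : (Fin n → ℝ) → ENNReal := fun x => p x * (d x * f (Mag n x / √(n : ℝ)))
  have hKm : Measurable K := hpm.mul (hdm.mul hfM)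
  have hL : Measurable fun g : Fin n → ℝ => fun i : Fin n =>
      ∑ k, hartley n k i * (√(a k) * g k) := by fun_prop
  have hlhs : ∫⁻ x, f (Mag n x / √(n : ℝ)) ∂(preμ n r) = ∫⁻ x, K x := by
    rw [preμ, lintegral_withDensity_eq_lintegral_mul _ hdm hfM, pi_gaussianReal_eq_withDensity,
      lintegral_withDensity_eq_lintegral_mul _ hpm (hdm.mul hfM)]
    rfl
  have hrad := lintegral_comp_radial_smul (fun g => √(normRatio a g)) (by fun_prop)
    (fun g hg => Real.sqrt_pos.2 (normRatio_pos ha hg))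
    (fun t ht g => by
      simp only [normRatio, Pi.smul_apply, smul_eq_mul, mul_pow, ← Finset.mul_sum,
        mul_left_comm _ (t ^ 2)]
      rw [mul_div_mul_left _ _ (by positivity)])
    (fun g : Fin n → ℝ => K (fun i => ∑ k, hartley n k i * (√(a k) * g k))) (hKm.comp hL)
  rw [hlhs, hC K hKm, ← hrad, mul_assoc, pi_gaussianReal_eq_withDensity,
    lintegral_withDensity_eq_lintegral_mul _ hpm hWf]
  congr 1
  rw [← lintegral_const_mul _ (hpm.mul hWf)]
  refine lintegral_congr_ae ?_
  filter_upwards [Measure.ae_ne volume (0 : Fin n → ℝ)] with g hg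
  have hw := normRatio_pos ha hg
  set w := normRatio a g with hwdef
  have hS := sum_sq_pos hg
  have hD := weighted_sum_sq_pos ha hg
  have hwD : w * ∑ k, a k * g k ^ 2 = ∑ k, g k ^ 2 := by
    rw [hwdef, normRatio, div_mul_cancel₀ _ hD.ne']
  set z : Fin n → ℝ := fun k => √(a k) * (√w • g) k with hz
  have hz2 : ∀ k, z k ^ 2 = w * (a k * g k ^ 2) := by
    intro k
    simp only [hz, Pi.smul_apply, smul_eq_mul, mul_pow, Real.sq_sqrt hw.le, Real.sq_sqrt (ha k).le]
    ring
  have hzsum : ∑ k, z k * z k = ∑ k, g k ^ 2 := by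
    simp_rw [← pow_two, hz2, ← Finset.mul_sum, hwD]
  have hx2 : ∑ i : Fin n, (∑ k, hartley n k i * z k) ^ 2 = ∑ k, g k ^ 2 := by
    simp_rw [pow_two (∑ k, hartley n k _ * z k)]
    rw [sum_hartley_transform_mul, hzsum]
  have hTx : Temp n (fun i => ∑ k, hartley n k i * z k) = (∑ k, g k ^ 2) / n := by
    rw [Temp, hx2]
  have hMx : Mag n (fun i => ∑ k, hartley n k i * z k) = √(n : ℝ) * z 0 := by
    rw [Mag, sum_hartley_transform]
  have hHx : Ham n r (fun i => ∑ k, hartley n k i * z k) =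
      -((s - w) * ∑ k, g k ^ 2) / 2 := by
    rw [Ham_hartley_transform]
    congr 2
    simp_rw [hz2]
    have : ∀ k : Fin n, dispersion r ((k : ℕ) / n) * (w * (a k * g k ^ 2)) =
        s * (w * (a k * g k ^ 2)) - w * g k ^ 2 := fun k => by linear_combination w * g k ^ 2 * has k
    simp_rw [this]
    rw [Finset.sum_sub_distrib, ← Finset.mul_sum, ← Finset.mul_sum, ← Finset.mul_sum, hwD]
    ring
  have hpw : √w ^ n = rexp (n / 2 * Real.log w) := by
    rw [mul_comm, ← Real.rpow_def_of_pos hw, Real.sqrt_eq_rpow, ← Real.rpow_natCast,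
      ← Real.rpow_mul hw.le]
    congr 1
    ring
  have harg : Mag n (fun i => ∑ k, hartley n k i * z k) / √(n : ℝ) = √w * (√(a 0) * g 0) := by
    have : √(n : ℝ) ≠ 0 := by positivity
    rw [hMx, mul_div_cancel_left₀ _ this, hz]
    simp only [Pi.smul_apply, smul_eq_mul]
    ring
  change ENNReal.ofReal (√w ^ Fintype.card (Fin n)) * K (fun i => ∑ k, hartley n k i * z k) =
    E * (p g * (ENNReal.ofReal (gibbsWeight a g) * f (√w * (√(a 0) * g 0))))
  simp only [K, hp, hd, hTx, hHx, harg, hx2, Fintype.card_fin]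
  rw [if_pos (by positivity), hpw, gibbsWeight, ← hwdef]
  have hexp : rexp (n / 2 * Real.log w) *
      rexp (-(-((s - w) * ∑ k, g k ^ 2) / 2) / ((∑ k, g k ^ 2) / n)) =
      rexp (n / 2 * (s - 1)) * rexp (-(n / 2) * (w - 1 - Real.log w)) := by
    rw [← Real.exp_add, ← Real.exp_add]
    congr 1
    field_simp
    ring
  have hexp2 := congrArg ENNReal.ofReal hexp
  rw [ENNReal.ofReal_mul (Real.exp_pos _).le, ENNReal.ofReal_mul (Real.exp_pos _).le] at hexp2
  rw [mul_left_comm, ← mul_assoc (ENNReal.ofReal (rexp (n / 2 * Real.log w))), hexp2, hE]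
  ring

lemma sum_sq_le_mul_weighted {n : ℕ} {K : ℝ} {a : Fin n → ℝ} (hK : 0 < K) (haK : ∀ k, 1 / K ≤ a k)
    (g : Fin n → ℝ) : ∑ k, g k ^ 2 ≤ K * ∑ k, a k * g k ^ 2 := by
  rw [Finset.mul_sum]
  refine Finset.sum_le_sum fun k _ => ?_
  have h := (div_le_iff₀' hK).1 (haK k)
  nlinarith [mul_le_mul_of_nonneg_right h (sq_nonneg (g k))]

lemma normRatio_le {n : ℕ} {K : ℝ} {a : Fin n → ℝ} (hK : 0 < K) (haK : ∀ k, 1 / K ≤ a k)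
    {g : Fin n → ℝ} (hg : g ≠ 0) : normRatio a g ≤ K := by
  have ha : ∀ k, 0 < a k := fun k => (one_div_pos.2 hK).trans_le (haK k)
  exact (div_le_iff₀ (weighted_sum_sq_pos ha hg)).2 (sum_sq_le_mul_weighted hK haK g)

lemma one_div_le_normRatio {n : ℕ} {K : ℝ} {a : Fin n → ℝ} (hK : 0 < K)
    (haK : ∀ k, 1 / K ≤ a k) (hKa : ∀ k, a k ≤ K) {g : Fin n → ℝ} (hg : g ≠ 0) :
    1 / K ≤ normRatio a g := by
  have ha : ∀ k, 0 < a k := fun k => (one_div_pos.2 hK).trans_le (haK k)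
  rw [normRatio, div_le_div_iff₀ hK (weighted_sum_sq_pos ha hg), one_mul, mul_comm, Finset.mul_sum]
  exact Finset.sum_le_sum fun k _ => mul_le_mul_of_nonneg_right (hKa k) (sq_nonneg _)

/-- The error functional controlling all approximations. -/
def errorTerm {n : ℕ} [NeZero n] (a g : Fin n → ℝ) : ℝ :=
  (1 + g 0 ^ 2) ^ 2 / √n +
    √n * ((∑ k, (1 - a k) * g k ^ 2) ^ 2 / n ^ 2 + ((∑ k, g k ^ 2) / n - 1) ^ 2)

lemma sq_normRatio_sub_one_le {n : ℕ} [NeZero n] {K : ℝ} {a : Fin n → ℝ} (hK : 1 ≤ K)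
    (haK : ∀ k, 1 / K ≤ a k) {g : Fin n → ℝ} (hg : g ≠ 0) :
    (normRatio a g - 1) ^ 2 ≤ 4 * K ^ 2 *
      ((∑ k, (1 - a k) * g k ^ 2) ^ 2 / n ^ 2 + ((∑ k, g k ^ 2) / n - 1) ^ 2) := by
  have hK0 : 0 < K := by linarith
  have hn : (0 : ℝ) < n := by exact_mod_cast NeZero.pos n
  have ha : ∀ k, 0 < a k := fun k => (one_div_pos.2 hK0).trans_le (haK k)
  have hD := weighted_sum_sq_pos ha hg
  have hKD := sum_sq_le_mul_weighted hK0 haK g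
  have hle := normRatio_le hK0 haK hg
  have hpos := normRatio_pos ha hg
  have hX : ∑ k, (1 - a k) * g k ^ 2 = ∑ k, g k ^ 2 - ∑ k, a k * g k ^ 2 := by
    rw [← Finset.sum_sub_distrib]
    exact Finset.sum_congr rfl fun k _ => by ring
  have hw : normRatio a g - 1 = (∑ k, (1 - a k) * g k ^ 2) / ∑ k, a k * g k ^ 2 := by
    rw [hX, normRatio, sub_div, div_self hD.ne']
  generalize ∑ k, (1 - a k) * g k ^ 2 = X at *
  generalize ∑ k, a k * g k ^ 2 = D at *
  generalize ∑ k, g k ^ 2 = N at *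
  rcases le_or_gt ((n : ℝ) / 2) N with h | h
  · have h1 : (normRatio a g - 1) ^ 2 ≤ 4 * K ^ 2 * (X ^ 2 / n ^ 2) := by
      rw [hw, div_pow, ← mul_div_assoc, div_le_div_iff₀ (by positivity) (by positivity)]
      have h2 : (n : ℝ) ^ 2 ≤ (2 * K * D) ^ 2 := pow_le_pow_left₀ hn.le (by linarith) 2
      nlinarith [mul_le_mul_of_nonneg_left h2 (sq_nonneg X)]
    have : 0 ≤ 4 * K ^ 2 * (N / n - 1) ^ 2 := by positivity
    linarith
  · have h1 : N / n < 1 / 2 := by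
      rw [div_lt_iff₀ hn]
      linarith
    have h2 : 1 / 4 ≤ (N / n - 1) ^ 2 := by nlinarith
    have h3 : (normRatio a g - 1) ^ 2 ≤ K ^ 2 := by
      apply sq_le_sq'
      · linarith
      · linarith
    have h4 : 0 ≤ X ^ 2 / (n : ℝ) ^ 2 := by positivity
    nlinarith [mul_le_mul_of_nonneg_left h2 (sq_nonneg K), mul_nonneg (sq_nonneg K) h4]

lemma errorTerm_nonneg {n : ℕ} [NeZero n] (a g : Fin n → ℝ) : 0 ≤ errorTerm a g := by
  unfold errorTerm
  positivity

lemma mul_abs_normRatio_sub_one_le {n : ℕ} [NeZero n] {K : ℝ} {a : Fin n → ℝ} (hK : 1 ≤ K)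
    (haK : ∀ k, 1 / K ≤ a k) {g : Fin n → ℝ} (hg : g ≠ 0) :
    (1 + g 0 ^ 2) * |normRatio a g - 1| ≤ 4 * K ^ 2 * errorTerm a g := by
  have hn : (0 : ℝ) < √n := Real.sqrt_pos.2 (by exact_mod_cast NeZero.pos n)
  have h := mul_le_mul_of_nonneg_left (sq_normRatio_sub_one_le hK haK hg) hn.le
  set q := √n * ((∑ k, (1 - a k) * g k ^ 2) ^ 2 / n ^ 2 + ((∑ k, g k ^ 2) / n - 1) ^ 2) with hq
  have hq0 : 0 ≤ q := by positivity
  have hE : errorTerm a g = (1 + g 0 ^ 2) ^ 2 / √n + q := rfl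
  set p := (1 + g 0 ^ 2) ^ 2 / √n with hp
  have hp0 : 0 ≤ p := by positivity
  have h1 : 2 * ((1 + g 0 ^ 2) * |normRatio a g - 1|) ≤ p + √n * (normRatio a g - 1) ^ 2 := by
    have h2 : p + √n * (normRatio a g - 1) ^ 2 - 2 * ((1 + g 0 ^ 2) * |normRatio a g - 1|) =
        ((1 + g 0 ^ 2) - √n * |normRatio a g - 1|) ^ 2 / √n := by
      rw [hp, ← sq_abs (normRatio a g - 1)]
      field_simp
      ring
    have : 0 ≤ ((1 + g 0 ^ 2) - √n * |normRatio a g - 1|) ^ 2 / √n := by positivity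
    linarith
  rw [hE]
  nlinarith [mul_nonneg (sq_nonneg K) hq0, mul_le_mul_of_nonneg_right (one_le_pow₀ hK (n := 2)) hp0]

lemma sub_one_sub_log_nonneg {w : ℝ} (hw : 0 < w) : 0 ≤ w - 1 - Real.log w := by
  linarith [Real.log_le_sub_one_of_pos hw]

lemma sub_one_sub_log_le {K w : ℝ} (hK : 0 < K) (hw : 1 / K ≤ w) :
    w - 1 - Real.log w ≤ K * (w - 1) ^ 2 := by
  have hw0 : 0 < w := (one_div_pos.2 hK).trans_le hw
  have h := Real.one_sub_inv_le_log_of_pos hw0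
  have h2 : w - 1 - (1 - w⁻¹) = w⁻¹ * (w - 1) ^ 2 := by
    field_simp
  have h3 : w⁻¹ ≤ K := by
    rw [← inv_inv K]
    exact inv_anti₀ (inv_pos.2 hK) (by simpa using hw)
  nlinarith [mul_le_mul_of_nonneg_right h3 (sq_nonneg (w - 1))]

lemma sub_one_sub_log_sub_le {K w v : ℝ} (hK : 0 < K) (hw : 1 / K ≤ w) (hv : 0 < v) :
    (w - 1 - Real.log w) - (v - 1 - Real.log v) ≤ K * (|w - v| * |w - 1|) := by
  have hw0 : 0 < w := (one_div_pos.2 hK).trans_le hw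
  have h := Real.one_sub_inv_le_log_of_pos (div_pos hw0 hv)
  rw [Real.log_div hw0.ne' hv.ne', inv_div] at h
  have h2 : (w - v) - (1 - v / w) = w⁻¹ * ((w - v) * (w - 1)) := by
    field_simp
  have h3 : w⁻¹ ≤ K := by
    rw [← inv_inv K]
    exact inv_anti₀ (inv_pos.2 hK) (by simpa using hw)
  calc _ ≤ w⁻¹ * ((w - v) * (w - 1)) := by linarith
    _ ≤ w⁻¹ * (|w - v| * |w - 1|) := by
      rw [← abs_mul]
      exact mul_le_mul_of_nonneg_left (le_abs_self _) (inv_pos.2 hw0).le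
    _ ≤ _ := mul_le_mul_of_nonneg_right h3 (by positivity)

lemma abs_sub_one_sub_log_sub_le {K w v : ℝ} (hK : 0 < K) (hw : 1 / K ≤ w) (hv : 1 / K ≤ v) :
    |(w - 1 - Real.log w) - (v - 1 - Real.log v)| ≤ K * (|w - v| * (|w - 1| + |w - v|)) := by
  have hw0 : 0 < w := (one_div_pos.2 hK).trans_le hw
  have hv0 : 0 < v := (one_div_pos.2 hK).trans_le hv
  have h1 := sub_one_sub_log_sub_le hK hw hv0
  have h2 := sub_one_sub_log_sub_le hK hv hw0
  rw [abs_sub_comm v w] at h2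
  have h3 : |v - 1| ≤ |w - 1| + |w - v| := by
    have := abs_sub_le v w 1
    rw [abs_sub_comm v w] at this
    linarith
  have h4 : |w - v| * |v - 1| ≤ |w - v| * (|w - 1| + |w - v|) :=
    mul_le_mul_of_nonneg_left h3 (abs_nonneg _)
  have h5 : |w - v| * |w - 1| ≤ |w - v| * (|w - 1| + |w - v|) :=
    mul_le_mul_of_nonneg_left (by linarith [abs_nonneg (w - v)]) (abs_nonneg _)
  rw [abs_le]
  constructor
  · linarith [mul_le_mul_of_nonneg_left h4 hK.le]
  · linarith [mul_le_mul_of_nonneg_left h5 hK.le]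

lemma abs_exp_neg_sub_exp_neg_le {x y : ℝ} (hx : 0 ≤ x) (hy : 0 ≤ y) :
    |rexp (-x) - rexp (-y)| ≤ |x - y| := by
  have key : ∀ u v : ℝ, 0 ≤ u → rexp (-u) - rexp (-v) ≤ |u - v| := by
    intro u v hu
    have h1 := Real.add_one_le_exp (u - v)
    have h2 : rexp (-v) = rexp (-u) * rexp (u - v) := by rw [← Real.exp_add]; ring_nf
    have h3 : rexp (-u) ≤ 1 := Real.exp_le_one_iff.2 (by linarith)
    have h4 := Real.exp_pos (-u)
    have h5 : rexp (-u) * (1 - rexp (u - v)) ≤ rexp (-u) * |u - v| :=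
      mul_le_mul_of_nonneg_left (by linarith [neg_abs_le (u - v)]) h4.le
    have h6 := mul_le_mul_of_nonneg_right h3 (abs_nonneg (u - v))
    rw [h2]
    linarith
  rw [abs_le]
  constructor
  · have := key y x hy
    rw [abs_sub_comm] at this
    linarith
  · exact key x y hx

lemma gibbsWeight_le_one {n : ℕ} {a g : Fin n → ℝ} (ha : ∀ k, 0 < a k) (hg : g ≠ 0) :
    gibbsWeight a g ≤ 1 := by
  have := sub_one_sub_log_nonneg (normRatio_pos ha hg)
  rw [gibbsWeight, Real.exp_le_one_iff, neg_mul]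
  exact neg_nonpos.2 (by positivity)

lemma update_zero_one_ne_zero {n : ℕ} [NeZero n] (g : Fin n → ℝ) : Function.update g 0 1 ≠ 0 := by
  intro h
  have := congrFun h 0
  simp at this

/-- Changing a single coordinate hardly affects `normRatio`. -/
lemma abs_normRatio_sub_update_le {n : ℕ} [NeZero n] {K : ℝ} {a : Fin n → ℝ} (hK : 1 ≤ K)
    (haK : ∀ k, 1 / K ≤ a k) (hKa : ∀ k, a k ≤ K) {g : Fin n → ℝ} (hg : g ≠ 0) :
    |normRatio a g - normRatio a (Function.update g 0 1)| ≤
      K ^ 3 * (1 + g 0 ^ 2) / ∑ k, g k ^ 2 := by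
  have hK0 : 0 < K := by linarith
  have ha : ∀ k, 0 < a k := fun k => (one_div_pos.2 hK0).trans_le (haK k)
  have hg' := update_zero_one_ne_zero g
  have hD := weighted_sum_sq_pos ha hg
  have hD' := weighted_sum_sq_pos ha hg'
  have hKD := sum_sq_le_mul_weighted hK0 haK g
  have hKD' := sum_sq_le_mul_weighted hK0 haK (Function.update g 0 1)
  have hN := sum_sq_pos hg
  have hrest : ∀ k ∈ Finset.univ.erase (0 : Fin n), Function.update g 0 1 k = g k := fun k hk =>
    Function.update_of_ne (Finset.ne_of_mem_erase hk) _ _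
  set N₁ := ∑ k ∈ Finset.univ.erase (0 : Fin n), g k ^ 2 with hN₁
  set D₁ := ∑ k ∈ Finset.univ.erase (0 : Fin n), a k * g k ^ 2 with hD₁
  have e1 : ∑ k, g k ^ 2 = g 0 ^ 2 + N₁ := (Finset.add_sum_erase _ _ (Finset.mem_univ 0)).symm
  have e2 : ∑ k, a k * g k ^ 2 = a 0 * g 0 ^ 2 + D₁ :=
    (Finset.add_sum_erase _ (fun k => a k * g k ^ 2) (Finset.mem_univ 0)).symm
  have e3 : ∑ k, Function.update g 0 1 k ^ 2 = 1 + N₁ := by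
    rw [← Finset.add_sum_erase _ _ (Finset.mem_univ 0), Function.update_self, one_pow,
      Finset.sum_congr rfl fun k hk => by rw [hrest k hk]]
  have e4 : ∑ k, a k * Function.update g 0 1 k ^ 2 = a 0 + D₁ := by
    rw [← Finset.add_sum_erase _ _ (Finset.mem_univ 0), Function.update_self, one_pow, mul_one,
      Finset.sum_congr rfl fun k hk => by rw [hrest k hk]]
  have hN₁0 : 0 ≤ N₁ := Finset.sum_nonneg fun _ _ => sq_nonneg _
  have hD₁0 : 0 ≤ D₁ := Finset.sum_nonneg fun k _ => mul_nonneg (ha k).le (sq_nonneg _)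
  have hD₁K : D₁ ≤ K * N₁ := by
    rw [hN₁, Finset.mul_sum]
    exact Finset.sum_le_sum fun k _ => mul_le_mul_of_nonneg_right (hKa k) (sq_nonneg _)
  unfold normRatio
  rw [e1] at hN hKD ⊢
  rw [e2] at hD hKD ⊢
  rw [e3] at hKD' ⊢
  rw [e4] at hD' hKD' ⊢
  clear e1 e2 e3 e4
  have ha0 := ha 0
  have haK0 := hKa 0
  generalize a 0 = α at *
  have ht : 0 ≤ g 0 ^ 2 := sq_nonneg _
  generalize g 0 ^ 2 = t at *
  rw [div_sub_div _ _ hD.ne' hD'.ne', abs_div, abs_of_pos (mul_pos hD hD'),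
    div_le_div_iff₀ (mul_pos hD hD') hN]
  have h1 : |(t + N₁) * (α + D₁) - (α * t + D₁) * (1 + N₁)| ≤ (1 + t) * (K * N₁) := by
    rw [show (t + N₁) * (α + D₁) - (α * t + D₁) * (1 + N₁) = (1 - t) * (α * N₁ - D₁) by ring,
      abs_mul]
    have hαN : α * N₁ ≤ K * N₁ := mul_le_mul_of_nonneg_right haK0 hN₁0
    have hαN0 : 0 ≤ α * N₁ := by positivity
    refine mul_le_mul ?_ ?_ (abs_nonneg _) (by positivity)
    · rw [abs_le]; constructor <;> linarith
    · rw [abs_le]; constructor <;> linarith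
  calc _ ≤ (1 + t) * (K * N₁) * (t + N₁) := mul_le_mul_of_nonneg_right h1 hN.le
    _ ≤ (1 + t) * (K * (1 + N₁)) * (t + N₁) := by gcongr; linarith
    _ ≤ (1 + t) * (K * (K * (α + D₁))) * (K * (α * t + D₁)) := by gcongr
    _ = _ := by ring

lemma abs_gibbsWeight_sub_update_le {n : ℕ} [NeZero n] {K : ℝ} {a : Fin n → ℝ} (hK : 1 ≤ K)
    (haK : ∀ k, 1 / K ≤ a k) (hKa : ∀ k, a k ≤ K) {g : Fin n → ℝ} (hg : g ≠ 0) :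
    |gibbsWeight a g - gibbsWeight a (Function.update g 0 1)| ≤ 10 * K ^ 7 * errorTerm a g := by
  have hK0 : 0 < K := by linarith
  have hn : (0 : ℝ) < n := by exact_mod_cast NeZero.pos n
  have hn1 : (1 : ℝ) ≤ n := by exact_mod_cast NeZero.one_le
  have hs : 0 < √(n : ℝ) := Real.sqrt_pos.2 hn
  have hs1 : 1 ≤ √(n : ℝ) := Real.one_le_sqrt.2 hn1
  have hsn : √(n : ℝ) ≤ n := Real.sqrt_le_iff.2 ⟨hn.le, by nlinarith⟩
  have ha : ∀ k, 0 < a k := fun k => (one_div_pos.2 hK0).trans_le (haK k)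
  have hg' := update_zero_one_ne_zero g
  have hE0 := errorTerm_nonneg a g
  have hK7 : 1 ≤ K ^ 7 := one_le_pow₀ hK
  rcases le_or_gt ((n : ℝ) / 2) (∑ k, g k ^ 2) with h | h
  · have hN : 0 < ∑ k, g k ^ 2 := by linarith
    have hw := one_div_le_normRatio hK0 haK hKa hg
    have hv := one_div_le_normRatio hK0 haK hKa hg'
    have hd : |normRatio a g - normRatio a (Function.update g 0 1)| ≤
        2 * K ^ 3 * (1 + g 0 ^ 2) / n := by
      refine (abs_normRatio_sub_update_le hK haK hKa hg).trans ?_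
      rw [div_le_div_iff₀ hN hn]
      have : 0 ≤ K ^ 3 * (1 + g 0 ^ 2) := by positivity
      nlinarith
    have hmul := mul_abs_normRatio_sub_one_le hK haK hg
    have hlog := abs_sub_one_sub_log_sub_le hK0 hw hv
    have hexp := abs_exp_neg_sub_exp_neg_le
      (mul_nonneg (half_pos hn).le (sub_one_sub_log_nonneg (normRatio_pos ha hg)))
      (mul_nonneg (half_pos hn).le (sub_one_sub_log_nonneg (normRatio_pos ha hg')))
    rw [← mul_sub, abs_mul, abs_of_pos (half_pos hn), ← neg_mul, ← neg_mul] at hexp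
    have hp : (1 + g 0 ^ 2) ^ 2 / n ≤ errorTerm a g := by
      have h1 : (1 + g 0 ^ 2) ^ 2 / (n : ℝ) ≤ (1 + g 0 ^ 2) ^ 2 / √n := by gcongr
      have h2 : 0 ≤ √n * ((∑ k, (1 - a k) * g k ^ 2) ^ 2 / n ^ 2 +
        ((∑ k, g k ^ 2) / n - 1) ^ 2) := by positivity
      unfold errorTerm
      linarith
    unfold gibbsWeight
    set w := normRatio a g
    set v := normRatio a (Function.update g 0 1)
    set u := 1 + g 0 ^ 2 with hu
    have hu0 : 0 < u := by positivity
    calc _ ≤ _ := hexp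
      _ ≤ n / 2 * (K * (|w - v| * (|w - 1| + |w - v|))) := by gcongr
      _ ≤ n / 2 * (K * (2 * K ^ 3 * u / n * (|w - 1| + 2 * K ^ 3 * u / n))) := by gcongr
      _ = K ^ 4 * (u * |w - 1|) + 2 * K ^ 7 * (u ^ 2 / n) := by
        field_simp
      _ ≤ K ^ 4 * (4 * K ^ 2 * errorTerm a g) + 2 * K ^ 7 * errorTerm a g := by gcongr
      _ = 4 * K ^ 6 * errorTerm a g + 2 * K ^ 7 * errorTerm a g := by ring
      _ ≤ 4 * K ^ 7 * errorTerm a g + 2 * K ^ 7 * errorTerm a g := by gcongr; norm_num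
      _ ≤ _ := by nlinarith
  · have h1 : (∑ k, g k ^ 2) / n < 1 / 2 := by
      rw [div_lt_iff₀ hn]
      linarith
    have h2 : 1 / 4 ≤ ((∑ k, g k ^ 2) / n - 1) ^ 2 := by nlinarith
    have h3 : 1 / 4 ≤ errorTerm a g := by
      have h4 : 0 ≤ (1 + g 0 ^ 2) ^ 2 / √n := by positivity
      have h5 : 0 ≤ (∑ k, (1 - a k) * g k ^ 2) ^ 2 / (n : ℝ) ^ 2 := by positivity
      unfold errorTerm
      nlinarith
    have h4 : |gibbsWeight a g - gibbsWeight a (Function.update g 0 1)| ≤ 1 := by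
      have h5 := gibbsWeight_le_one ha hg
      have h6 := gibbsWeight_le_one ha hg'
      have h7 : 0 < gibbsWeight a g := Real.exp_pos _
      have h8 : 0 < gibbsWeight a (Function.update g 0 1) := Real.exp_pos _
      rw [abs_le]
      constructor <;> linarith
    nlinarith

lemma memLp_mul_sq_gaussianReal (c : ℝ) :
    MemLp (fun t : ℝ => c * t ^ 2) 2 (gaussianReal 0 1) := by
  refine MemLp.const_mul ?_ c
  rw [memLp_two_iff_integrable_sq (by fun_prop)]
  refine (MemLp.integrable_norm_pow (memLp_id_gaussianReal' 4 (by simp)) (p := 4)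
    (by norm_num)).congr (ae_of_all _ fun t => ?_)
  simp only [id, Real.norm_eq_abs]
  rw [← pow_mul, Even.pow_abs (by decide)]

lemma integral_mul_sq_gaussianReal (c : ℝ) : ∫ t : ℝ, c * t ^ 2 ∂(gaussianReal 0 1) = c := by
  have h := variance_eq_sub (memLp_id_gaussianReal (μ := 0) (v := 1) 2)
  rw [variance_id_gaussianReal] at h
  simp only [id, integral_id_gaussianReal, Pi.pow_apply] at h
  rw [integral_const_mul, ← sub_zero (∫ t : ℝ, t ^ 2 ∂_)]
  norm_num at h
  rw [sub_zero, ← h, mul_one]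

lemma memLp_sum_mul_sq {n : ℕ} (c : Fin n → ℝ) :
    MemLp (fun g : Fin n → ℝ => ∑ k, c k * g k ^ 2) 2
      (Measure.pi fun _ : Fin n => gaussianReal 0 1) :=
  memLp_finsetSum _ fun k _ => (memLp_mul_sq_gaussianReal (c k)).comp_measurePreserving
    (measurePreserving_eval (fun _ : Fin n => gaussianReal 0 1) k)

lemma integral_sum_mul_sq {n : ℕ} (c : Fin n → ℝ) :
    ∫ g : Fin n → ℝ, ∑ k, c k * g k ^ 2 ∂(Measure.pi fun _ : Fin n => gaussianReal 0 1) =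
      ∑ k, c k := by
  rw [integral_finsetSum]
  · refine Finset.sum_congr rfl fun k _ => ?_
    rw [integral_comp_eval (X := fun _ : Fin n => ℝ) (μ := fun _ : Fin n => gaussianReal 0 1)
      (f := fun t : ℝ => c k * t ^ 2) (by fun_prop)]
    exact integral_mul_sq_gaussianReal _
  · exact fun k _ => (((memLp_mul_sq_gaussianReal (c k)).comp_measurePreserving
      (measurePreserving_eval (fun _ : Fin n => gaussianReal 0 1) k)).integrable (by norm_num))

lemma integral_sq_sum_mul_sq {n : ℕ} (c : Fin n → ℝ) :
    ∫ g : Fin n → ℝ, (∑ k, c k * g k ^ 2) ^ 2 ∂(Measure.pi fun _ : Fin n => gaussianReal 0 1) =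
      (∑ k, c k) ^ 2 + Var[fun t : ℝ => t ^ 2; gaussianReal 0 1] * ∑ k, c k ^ 2 := by
  have h := variance_sum_pi (μ := fun _ : Fin n => gaussianReal 0 1)
    (X := fun k t => c k * t ^ 2) fun k => memLp_mul_sq_gaussianReal (c k)
  have e : (∑ k, fun g : Fin n → ℝ => c k * g k ^ 2) =
      fun g : Fin n → ℝ => ∑ k, c k * g k ^ 2 := by
    ext g
    simp
  rw [e, variance_eq_sub (memLp_sum_mul_sq c), integral_sum_mul_sq] at h
  simp only [Pi.pow_apply, variance_const_mul] at h
  rw [Finset.mul_sum, ← sub_eq_iff_eq_add', h]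
  exact Finset.sum_congr rfl fun k _ => mul_comm _ _

lemma integrable_sq_sum_div_sub_one {n : ℕ} :
    Integrable (fun g : Fin n → ℝ => ((∑ k, g k ^ 2) / n - 1) ^ 2)
      (Measure.pi fun _ : Fin n => gaussianReal 0 1) := by
  have h := (memLp_sum_mul_sq fun _ : Fin n => (1 / n : ℝ)).sub (memLp_const (1 : ℝ))
  refine h.integrable_sq.congr (ae_of_all _ fun g => ?_)
  simp only [Pi.sub_apply, ← Finset.mul_sum]
  ring

lemma integral_sq_sum_div_sub_one {n : ℕ} [NeZero n] :
    ∫ g : Fin n → ℝ, ((∑ k, g k ^ 2) / n - 1) ^ 2 ∂(Measure.pi fun _ : Fin n => gaussianReal 0 1) =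
      Var[fun t : ℝ => t ^ 2; gaussianReal 0 1] / n := by
  have hn : (n : ℝ) ≠ 0 := NeZero.ne _
  have hc : ∑ _k : Fin n, (1 / n : ℝ) = 1 := by
    simp [hn]
  have h := memLp_sum_mul_sq fun _ : Fin n => (1 / n : ℝ)
  have h1 := integral_sum_mul_sq fun _ : Fin n => (1 / n : ℝ)
  have h2 := integral_sq_sum_mul_sq fun _ : Fin n => (1 / n : ℝ)
  rw [hc] at h1 h2
  have e : ∀ g : Fin n → ℝ, ((∑ k, g k ^ 2) / n - 1) ^ 2 =
      (∑ k, (1 / n : ℝ) * g k ^ 2) ^ 2 - 2 * (∑ k, (1 / n : ℝ) * g k ^ 2) + 1 := fun g => by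
    rw [← Finset.mul_sum]
    ring
  simp only [e]
  have i1 := (h.integrable (by norm_num)).const_mul 2
  have i2 : Integrable (fun g : Fin n → ℝ => (∑ k, (1 / n : ℝ) * g k ^ 2) ^ 2 -
      2 * (∑ k, (1 / n : ℝ) * g k ^ 2)) (Measure.pi fun _ : Fin n => gaussianReal 0 1) :=
    h.integrable_sq.sub i1
  rw [integral_add i2 (integrable_const _), integral_sub h.integrable_sq i1,
    integral_const_mul, h1, h2]
  simp
  field_simp
  ring

lemma integrable_one_add_sq_sq_gaussianReal :
    Integrable (fun t : ℝ => (1 + t ^ 2) ^ 2) (gaussianReal 0 1) := by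
  refine ((memLp_const (1 : ℝ)).add (memLp_mul_sq_gaussianReal 1)).integrable_sq.congr
    (ae_of_all _ fun t => ?_)
  simp

/-- First moment of the squared deviation and of the error functional. -/
lemma exists_integral_errorTerm_le (K R : ℝ) : ∃ M : ℝ, 0 ≤ M ∧ ∀ (n : ℕ) [NeZero n]
    (a : Fin n → ℝ), (∀ k, |1 - a k| ≤ K) → |∑ k, (1 - a k)| ≤ R →
      Integrable (fun g : Fin n → ℝ =>
        (∑ k, (1 - a k) * g k ^ 2) ^ 2 / (n : ℝ) ^ 2 + ((∑ k, g k ^ 2) / n - 1) ^ 2)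
        (Measure.pi fun _ : Fin n => gaussianReal 0 1) ∧
      ∫ g : Fin n → ℝ, (∑ k, (1 - a k) * g k ^ 2) ^ 2 / (n : ℝ) ^ 2 + ((∑ k, g k ^ 2) / n - 1) ^ 2
        ∂(Measure.pi fun _ : Fin n => gaussianReal 0 1) ≤ M / (n : ℝ) ∧
      Integrable (errorTerm a) (Measure.pi fun _ : Fin n => gaussianReal 0 1) ∧
      ∫ g, errorTerm a g ∂(Measure.pi fun _ : Fin n => gaussianReal 0 1) ≤ M / √n := by
  set v := Var[fun t : ℝ => t ^ 2; gaussianReal 0 1] with hv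
  have hv0 : 0 ≤ v := variance_nonneg _ _
  set q := ∫ t : ℝ, (1 + t ^ 2) ^ 2 ∂(gaussianReal 0 1) with hq
  have hq0 : 0 ≤ q := integral_nonneg fun t => by positivity
  refine ⟨R ^ 2 + v * K ^ 2 + v + q, by positivity, fun n _ a haK haR => ?_⟩
  have hn : (0 : ℝ) < n := by exact_mod_cast NeZero.pos n
  have hn1 : (1 : ℝ) ≤ n := by exact_mod_cast NeZero.one_le
  have hs : 0 < √(n : ℝ) := Real.sqrt_pos.2 hn
  have i1 := (memLp_sum_mul_sq fun k => 1 - a k).integrable_sq.div_const ((n : ℝ) ^ 2)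
  have i2 : Integrable (fun g : Fin n → ℝ =>
      (∑ k, (1 - a k) * g k ^ 2) ^ 2 / (n : ℝ) ^ 2 + ((∑ k, g k ^ 2) / n - 1) ^ 2)
      (Measure.pi fun _ : Fin n => gaussianReal 0 1) := i1.add integrable_sq_sum_div_sub_one
  have hR : (∑ k, (1 - a k)) ^ 2 ≤ R ^ 2 := by
    rw [← sq_abs]
    exact pow_le_pow_left₀ (abs_nonneg _) haR 2
  have hK : ∑ k, (1 - a k) ^ 2 ≤ n * K ^ 2 := by
    refine (Finset.sum_le_card_nsmul _ _ (K ^ 2) fun k _ => ?_).trans (by simp)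
    rw [← sq_abs]
    exact pow_le_pow_left₀ (abs_nonneg _) (haK k) 2
  have b : ∫ g : Fin n → ℝ, (∑ k, (1 - a k) * g k ^ 2) ^ 2 / (n : ℝ) ^ 2 + ((∑ k, g k ^ 2) / n - 1) ^ 2
        ∂(Measure.pi fun _ : Fin n => gaussianReal 0 1) ≤ (R ^ 2 + v * K ^ 2 + v) / n := by
    rw [integral_add i1 integrable_sq_sum_div_sub_one, integral_div, integral_sq_sum_mul_sq,
      integral_sq_sum_div_sub_one, ← hv, add_div _ v, add_le_add_iff_right,
      div_le_div_iff₀ (by positivity) hn]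
    have h1 := mul_le_mul_of_nonneg_left hK hv0
    have h2 : R ^ 2 ≤ n * R ^ 2 := le_mul_of_one_le_left (sq_nonneg R) hn1
    nlinarith
  have i3 : Integrable (fun g : Fin n → ℝ => (1 + g 0 ^ 2) ^ 2 / √(n : ℝ))
      (Measure.pi fun _ : Fin n => gaussianReal 0 1) :=
    ((measurePreserving_eval (fun _ : Fin n => gaussianReal 0 1) 0).integrable_comp_of_integrable
      integrable_one_add_sq_sq_gaussianReal).div_const _
  refine ⟨i2, b.trans ?_, i3.add (i2.const_mul _), ?_⟩
  · exact div_le_div_of_nonneg_right (by linarith) hn.le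
  · unfold errorTerm
    rw [integral_add i3 (i2.const_mul _), integral_const_mul, integral_div,
      integral_comp_eval (X := fun _ : Fin n => ℝ) (μ := fun _ : Fin n => gaussianReal 0 1)
        (f := fun t : ℝ => (1 + t ^ 2) ^ 2) (by fun_prop)]
    refine (add_le_add_right (mul_le_mul_of_nonneg_left b hs.le) _).trans_eq ?_
    rw [← hq]
    have : (n : ℝ) = √(n : ℝ) ^ 2 := (Real.sq_sqrt hn.le).symm
    field_simp
    rw [← this]
    field_simp
    ring

lemma ae_ne_zero_pi_gaussianReal {n : ℕ} [NeZero n] :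
    ∀ᵐ g ∂(Measure.pi fun _ : Fin n => gaussianReal 0 1), g ≠ 0 := by
  have : NullSingletonClass (gaussianReal 0 1 : Measure ℝ) := nullSingletonClass_gaussianReal one_ne_zero
  have : NullSingletonClass (Measure.pi fun _ : Fin n => gaussianReal 0 1) := Measure.pi_nullSingletonClass 0
  exact measure_mono_null (fun g hg => not_not.1 hg) (measure_singleton (0 : Fin n → ℝ))

lemma gibbsWeight_pos {n : ℕ} (a g : Fin n → ℝ) : 0 < gibbsWeight a g := Real.exp_pos _

lemma integrable_gibbsWeight {n : ℕ} [NeZero n] {a : Fin n → ℝ} (ha : ∀ k, 0 < a k) :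
    Integrable (gibbsWeight a) (Measure.pi fun _ : Fin n => gaussianReal 0 1) := by
  refine Integrable.of_bound (measurable_gibbsWeight a).aestronglyMeasurable 1 ?_
  filter_upwards [ae_ne_zero_pi_gaussianReal] with g hg
  rw [Real.norm_of_nonneg (gibbsWeight_pos a g).le]
  exact gibbsWeight_le_one ha hg

/-- The total weight is bounded below by Jensen's inequality. -/
lemma exp_neg_le_integral_gibbsWeight {n : ℕ} [NeZero n] {K m : ℝ} {a : Fin n → ℝ} (hK : 1 ≤ K)
    (haK : ∀ k, 1 / K ≤ a k) (hKa : ∀ k, a k ≤ K)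
    (hint : Integrable (fun g : Fin n → ℝ =>
        (∑ k, (1 - a k) * g k ^ 2) ^ 2 / (n : ℝ) ^ 2 + ((∑ k, g k ^ 2) / n - 1) ^ 2)
        (Measure.pi fun _ : Fin n => gaussianReal 0 1))
    (hm : ∫ g : Fin n → ℝ,
        (∑ k, (1 - a k) * g k ^ 2) ^ 2 / (n : ℝ) ^ 2 + ((∑ k, g k ^ 2) / n - 1) ^ 2
        ∂(Measure.pi fun _ : Fin n => gaussianReal 0 1) ≤ m / n) :
    rexp (-(2 * K ^ 3 * m)) ≤
      ∫ g, gibbsWeight a g ∂(Measure.pi fun _ : Fin n => gaussianReal 0 1) := by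
  have hK0 : 0 < K := by linarith
  have hn : (0 : ℝ) < n := by exact_mod_cast NeZero.pos n
  have ha : ∀ k, 0 < a k := fun k => (one_div_pos.2 hK0).trans_le (haK k)
  set b := 2 * K ^ 3 * m with hb
  have hlow : ∫ g : Fin n → ℝ, rexp (-b) * (1 + b) - rexp (-b) * (2 * n * K ^ 3) *
      ((∑ k, (1 - a k) * g k ^ 2) ^ 2 / (n : ℝ) ^ 2 + ((∑ k, g k ^ 2) / n - 1) ^ 2)
      ∂(Measure.pi fun _ : Fin n => gaussianReal 0 1) ≤
      ∫ g, gibbsWeight a g ∂(Measure.pi fun _ : Fin n => gaussianReal 0 1) := by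
    refine integral_mono_ae ((integrable_const _).sub (hint.const_mul _))
      (integrable_gibbsWeight ha) ?_
    filter_upwards [ae_ne_zero_pi_gaussianReal] with g hg
    have h1 := sub_one_sub_log_le hK0 (one_div_le_normRatio hK0 haK hKa hg)
    have h2 := sq_normRatio_sub_one_le hK haK hg
    set q := (∑ k, (1 - a k) * g k ^ 2) ^ 2 / (n : ℝ) ^ 2 + ((∑ k, g k ^ 2) / n - 1) ^ 2
    set w := normRatio a g with hw
    have h3 : (n : ℝ) / 2 * (w - 1 - Real.log w) ≤ 2 * n * K ^ 3 * q :=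
      calc _ ≤ (n : ℝ) / 2 * (K * (4 * K ^ 2 * q)) := by
            gcongr
            exact h1.trans (mul_le_mul_of_nonneg_left h2 hK0.le)
        _ = _ := by ring
    have h4 := Real.add_one_le_exp (b - n / 2 * (w - 1 - Real.log w))
    have h5 : gibbsWeight a g = rexp (-b) * rexp (b - n / 2 * (w - 1 - Real.log w)) := by
      rw [← Real.exp_add, gibbsWeight]
      congr 1
      ring
    rw [h5]
    have h6 := Real.exp_pos (-b)
    calc _ = rexp (-b) * (1 + b - 2 * n * K ^ 3 * q) := by ring
      _ ≤ _ := mul_le_mul_of_nonneg_left (by linarith) h6.le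
  refine le_trans ?_ hlow
  rw [integral_sub (integrable_const _) (hint.const_mul _),
    integral_const_mul (rexp (-b) * (2 * n * K ^ 3))]
  simp only [integral_const, probReal_univ, one_smul]
  have h7 : (2 * n * K ^ 3) * (m / n) = b := by
    rw [hb]
    field_simp
  have h8 := mul_le_mul_of_nonneg_left hm (by positivity : 0 ≤ rexp (-b) * (2 * n * K ^ 3))
  rw [mul_assoc _ _ (m / n), h7] at h8
  linarith

lemma integral_mul_comp_update_zero {n : ℕ} [NeZero n] {f : ℝ → ℝ} {h : (Fin n → ℝ) → ℝ}
    (hf : Measurable f) (hh : Measurable h) :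
    ∫ g : Fin n → ℝ, f (g 0) * h (Function.update g 0 1)
        ∂(Measure.pi fun _ : Fin n => gaussianReal 0 1) =
      (∫ g : Fin n → ℝ, f (g 0) ∂(Measure.pi fun _ : Fin n => gaussianReal 0 1)) *
        ∫ g : Fin n → ℝ, h (Function.update g 0 1)
          ∂(Measure.pi fun _ : Fin n => gaussianReal 0 1) := by
  have hi := iIndepFun_pi (μ := fun _ : Fin n => gaussianReal 0 1) (X := fun _ => id)
    fun _ => aemeasurable_id
  have hST := hi.indepFun_finset {0} (Finset.univ.erase 0) (by simp)
    fun i => measurable_pi_apply i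
  have hF : Measurable fun u : ({0} : Finset (Fin n)) → ℝ => f (u ⟨0, by simp⟩) :=
    hf.comp (measurable_pi_apply _)
  have hG : Measurable fun u : (Finset.univ.erase (0 : Fin n) : Finset (Fin n)) → ℝ =>
      h fun i => if hi : i ∈ Finset.univ.erase (0 : Fin n) then u ⟨i, hi⟩ else 1 := by
    refine hh.comp (measurable_pi_lambda _ fun i => ?_)
    by_cases hi : i ∈ Finset.univ.erase (0 : Fin n)
    · simp only [hi, dite_true]
      exact measurable_pi_apply _
    · simp only [hi, dite_false]
      exact measurable_const
  have hu : ∀ g : Fin n → ℝ, (fun i => if i = 0 then 1 else g i) = Function.update g 0 1 := fun g => by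
    ext i
    rw [Function.update_apply]
  have key := (hST.comp hF hG).integral_fun_mul_eq_mul_integral
    (hF.comp (measurable_pi_lambda _ fun i => measurable_pi_apply _)).aestronglyMeasurable
    (hG.comp (measurable_pi_lambda _ fun i => measurable_pi_apply _)).aestronglyMeasurable
  simpa [Function.comp_def, hu] using key

/-- Under the weight, the rescaled coordinate `g 0` is almost Gaussian. -/
lemma abs_integral_mul_gibbsWeight_sub_le {n : ℕ} [NeZero n] {K L M : ℝ} {a : Fin n → ℝ}
    (hK : 1 ≤ K) (haK : ∀ k, 1 / K ≤ a k) (hKa : ∀ k, a k ≤ K)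
    (hint : Integrable (errorTerm a) (Measure.pi fun _ : Fin n => gaussianReal 0 1))
    {f : ℝ → ℝ} (hf : Measurable f) (hL : 0 ≤ L) (hfL : ∀ x y, |f x - f y| ≤ L * |x - y|)
    (hfM : ∀ x, |f x| ≤ M) :
    |∫ g : Fin n → ℝ, f (√(normRatio a g) * (√(a 0) * g 0)) * gibbsWeight a g
        ∂(Measure.pi fun _ : Fin n => gaussianReal 0 1) -
      (∫ g : Fin n → ℝ, f (√(a 0) * g 0) ∂(Measure.pi fun _ : Fin n => gaussianReal 0 1)) *
        ∫ g, gibbsWeight a g ∂(Measure.pi fun _ : Fin n => gaussianReal 0 1)| ≤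
      (4 * L * K ^ 3 + 20 * M * K ^ 7) *
        ∫ g, errorTerm a g ∂(Measure.pi fun _ : Fin n => gaussianReal 0 1) := by
  have hK0 : 0 < K := by linarith
  have ha : ∀ k, 0 < a k := fun k => (one_div_pos.2 hK0).trans_le (haK k)
  have hM : 0 ≤ M := (abs_nonneg _).trans (hfM 0)
  have hf0 : Measurable fun t : ℝ => f (√(a 0) * t) := hf.comp (measurable_const_mul _)
  have hF0 : Measurable fun g : Fin n → ℝ => f (√(a 0) * g 0) :=
    hf0.comp (measurable_pi_apply 0)
  have hF : Measurable fun g : Fin n → ℝ => f (√(normRatio a g) * (√(a 0) * g 0)) :=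
    hf.comp ((measurable_normRatio a).sqrt.mul ((measurable_pi_apply 0).const_mul _))
  have hW := measurable_gibbsWeight a
  have hU : Measurable fun g : Fin n → ℝ => Function.update g 0 1 :=
    measurable_pi_lambda _ fun i => by
      by_cases hi : i = 0
      · subst hi
        simp
      · simpa [Function.update_of_ne hi] using measurable_pi_apply i
  have iW := integrable_gibbsWeight ha
  have iW' : Integrable (fun g => gibbsWeight a (Function.update g 0 1))
      (Measure.pi fun _ : Fin n => gaussianReal 0 1) := by
    refine Integrable.of_bound (hW.comp hU).aestronglyMeasurable 1 (ae_of_all _ fun g => ?_)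
    rw [Real.norm_of_nonneg (gibbsWeight_pos _ _).le]
    exact gibbsWeight_le_one ha (update_zero_one_ne_zero g)
  have i1 := iW.bdd_mul hF.aestronglyMeasurable (ae_of_all _ fun g => hfM _)
  have i2 := iW'.bdd_mul hF0.aestronglyMeasurable (ae_of_all _ fun g => hfM _)
  have hind := integral_mul_comp_update_zero hf0 hW
  set I := ∫ g : Fin n → ℝ, f (√(a 0) * g 0) ∂(Measure.pi fun _ : Fin n => gaussianReal 0 1)
  have hI : |I| ≤ M := by
    have := norm_integral_le_of_norm_le_const (μ := Measure.pi fun _ : Fin n => gaussianReal 0 1)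
      (f := fun g : Fin n → ℝ => f (√(a 0) * g 0)) (ae_of_all _ fun g => hfM (√(a 0) * g 0))
    simpa using this
  have e : ∫ g : Fin n → ℝ, f (√(normRatio a g) * (√(a 0) * g 0)) * gibbsWeight a g
        ∂(Measure.pi fun _ : Fin n => gaussianReal 0 1) -
      I * ∫ g, gibbsWeight a g ∂(Measure.pi fun _ : Fin n => gaussianReal 0 1) =
      ∫ g : Fin n → ℝ, f (√(normRatio a g) * (√(a 0) * g 0)) * gibbsWeight a g -
        f (√(a 0) * g 0) * gibbsWeight a (Function.update g 0 1) +
        (I * gibbsWeight a (Function.update g 0 1) - I * gibbsWeight a g)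
        ∂(Measure.pi fun _ : Fin n => gaussianReal 0 1) := by
    have i3 : Integrable (fun g => I * gibbsWeight a (Function.update g 0 1) - I * gibbsWeight a g)
        (Measure.pi fun _ : Fin n => gaussianReal 0 1) :=
      (iW'.const_mul I).sub (iW.const_mul I)
    have i4 : Integrable (fun g => f (√(normRatio a g) * (√(a 0) * g 0)) * gibbsWeight a g -
        f (√(a 0) * g 0) * gibbsWeight a (Function.update g 0 1))
        (Measure.pi fun _ : Fin n => gaussianReal 0 1) := i1.sub i2
    rw [integral_add i4 i3, integral_sub i1 i2, integral_sub (iW'.const_mul I) (iW.const_mul I),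
      hind, integral_const_mul, integral_const_mul]
    ring
  rw [e, ← integral_const_mul, ← Real.norm_eq_abs]
  refine norm_integral_le_of_norm_le (hint.const_mul _) ?_
  filter_upwards [ae_ne_zero_pi_gaussianReal] with g hg
  have hd := abs_gibbsWeight_sub_update_le hK haK hKa hg
  have hr := mul_abs_normRatio_sub_one_le hK haK hg
  have hw1 := gibbsWeight_le_one ha hg
  have hw0 : 0 ≤ gibbsWeight a g := (gibbsWeight_pos a g).le
  have hpos := normRatio_pos ha hg
  have hsq : |√(normRatio a g) - 1| ≤ |normRatio a g - 1| := by
    have h1 : normRatio a g - 1 = (√(normRatio a g) - 1) * (√(normRatio a g) + 1) := by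
      nlinarith [Real.sq_sqrt hpos.le]
    have h2 := Real.sqrt_nonneg (normRatio a g)
    rw [h1, abs_mul, abs_of_pos (by linarith : 0 < √(normRatio a g) + 1)]
    exact le_mul_of_one_le_right (abs_nonneg _) (by linarith)
  have hsa : √(a 0) ≤ K := Real.sqrt_le_iff.2 ⟨hK0.le, (hKa 0).trans (by nlinarith)⟩
  have hg0 : |g 0| ≤ 1 + g 0 ^ 2 := by
    rw [← sq_abs]
    nlinarith [sq_nonneg (|g 0| - 1)]
  have hE := errorTerm_nonneg a g
  have t1 : |f (√(normRatio a g) * (√(a 0) * g 0)) - f (√(a 0) * g 0)| ≤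
      4 * L * K ^ 3 * errorTerm a g :=
    calc _ ≤ L * |√(normRatio a g) * (√(a 0) * g 0) - √(a 0) * g 0| := hfL _ _
      _ = L * (√(a 0) * (|g 0| * |√(normRatio a g) - 1|)) := by
        rw [show √(normRatio a g) * (√(a 0) * g 0) - √(a 0) * g 0 =
          √(a 0) * (g 0 * (√(normRatio a g) - 1)) by ring, abs_mul, abs_mul,
          abs_of_nonneg (Real.sqrt_nonneg _)]
      _ ≤ L * (K * ((1 + g 0 ^ 2) * |normRatio a g - 1|)) := by gcongr
      _ ≤ L * (K * (4 * K ^ 2 * errorTerm a g)) := by gcongr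
      _ = _ := by ring
  set F := f (√(normRatio a g) * (√(a 0) * g 0))
  set F₀ := f (√(a 0) * g 0)
  have hF₀ : |F₀| ≤ M := hfM _
  set W := gibbsWeight a g
  set W' := gibbsWeight a (Function.update g 0 1)
  have hsplit : F * W - F₀ * W' + (I * W' - I * W) = (F - F₀) * W + (F₀ - I) * (W - W') := by ring
  rw [Real.norm_eq_abs, hsplit]
  have hFI : |F₀ - I| ≤ 2 * M := (abs_sub _ _).trans (by linarith)
  calc _ ≤ |F - F₀| * |W| + |F₀ - I| * |W - W'| := by
        rw [← abs_mul, ← abs_mul]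
        exact abs_add_le _ _
    _ ≤ 4 * L * K ^ 3 * errorTerm a g * 1 + 2 * M * (10 * K ^ 7 * errorTerm a g) := by
        gcongr
        rwa [abs_of_nonneg hw0]
    _ = _ := by ring

lemma abs_sum_sub_mul_integral_le {f : ℝ → ℝ} {Λ : ℝ} (hΛ : ∀ x y, |f x - f y| ≤ Λ * |x - y|)
    (hΛ0 : 0 ≤ Λ) (n : ℕ) [NeZero n] :
    |∑ k : Fin n, f ((k : ℕ) / n) - n * ∫ t in (0 : ℝ)..1, f t| ≤ Λ := by
  have hn : (0 : ℝ) < n := by exact_mod_cast NeZero.pos n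
  have hf : Continuous f :=
    (LipschitzWith.of_dist_le_mul (K := Λ.toNNReal) fun x y => by
      simpa [Real.dist_eq, Real.coe_toNNReal _ hΛ0] using hΛ x y).continuous
  have hc : Continuous fun x : ℝ => f (x / n) := by fun_prop
  have hi : (n : ℝ) * ∫ t in (0 : ℝ)..1, f t = ∑ k ∈ Finset.range n,
      ∫ x in (k : ℝ)..((k + 1 : ℕ) : ℝ), f (x / n) := by
    rw [intervalIntegral.sum_integral_adjacent_intervals
      (a := fun k : ℕ => (k : ℝ)) fun k _ => hc.intervalIntegrable _ _,
      intervalIntegral.integral_comp_div _ hn.ne']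
    simp [hn.ne']
  rw [hi, Fin.sum_univ_eq_sum_range (fun k : ℕ => f ((k : ℝ) / n)) n, ← Finset.sum_sub_distrib]
  have hk : ∀ k : ℕ, |f ((k : ℝ) / n) - ∫ x in (k : ℝ)..((k + 1 : ℕ) : ℝ), f (x / n)| ≤
      Λ * (1 / n) := by
    intro k
    have h1 : f ((k : ℝ) / n) - ∫ x in (k : ℝ)..((k + 1 : ℕ) : ℝ), f (x / n) =
        ∫ x in (k : ℝ)..((k + 1 : ℕ) : ℝ), (f ((k : ℝ) / n) - f (x / n)) := by
      rw [intervalIntegral.integral_sub intervalIntegrable_const (hc.intervalIntegrable _ _)]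
      simp
    rw [h1]
    rw [show Λ * (1 / (n : ℝ)) = Λ * (1 / n) * |((k + 1 : ℕ) : ℝ) - k| by simp,
      ← Real.norm_eq_abs]
    refine intervalIntegral.norm_integral_le_of_norm_le_const fun x hx => ?_
    rw [Set.uIoc_of_le (by push_cast; linarith)] at hx
    obtain ⟨hx1, hx2⟩ := hx
    push_cast at hx2
    refine (hΛ _ _).trans (mul_le_mul_of_nonneg_left ?_ hΛ0)
    rw [← sub_div, abs_div, abs_of_pos hn]
    gcongr
    rw [abs_le]
    constructor <;> linarith
  refine (Finset.abs_sum_le_sum_abs _ _).trans ((Finset.sum_le_card_nsmul _ _ _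
    fun k _ => hk k).trans_eq ?_)
  simp
  field_simp

lemma abs_dispersion_le (r : ℕ) (t : ℝ) : |dispersion r t| ≤ 1 := by
  unfold dispersion
  rw [abs_mul, abs_of_nonneg (by positivity), one_div_mul_eq_div]
  refine div_le_one_of_le₀ ((Finset.abs_sum_le_sum_abs _ _).trans
    ((Finset.sum_le_card_nsmul _ _ 1 fun m _ => Real.abs_cos_le_one _).trans ?_)) (by positivity)
  simp

lemma dispersion_zero {r : ℕ} (hr : 1 ≤ r) : dispersion r 0 = 1 := by
  have : (r : ℝ) ≠ 0 := by positivity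
  simp [dispersion, this]

lemma abs_dispersion_sub_le (r : ℕ) (x y : ℝ) :
    |dispersion r x - dispersion r y| ≤ 2 * π * r * |x - y| := by
  unfold dispersion
  rw [← mul_sub, ← Finset.sum_sub_distrib, abs_mul, abs_of_nonneg (by positivity),
    one_div_mul_eq_div]
  refine div_le_of_le_mul₀ (by positivity) (by positivity)
    ((Finset.abs_sum_le_sum_abs _ _).trans ((Finset.sum_le_card_nsmul _ _
      (2 * π * r * |x - y|) fun m hm => ?_).trans_eq ?_))
  · refine (Real.abs_cos_sub_cos_le _ _).trans ?_
    rw [← mul_sub, abs_mul, abs_of_nonneg (by positivity)]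
    gcongr
    exact (Finset.mem_Icc.1 hm).2
  · simp [mul_comm]

/-- The limiting spectral profile of the model. -/
def profile (r : ℕ) (σ t : ℝ) : ℝ := (1 / σ ^ 2 + 1 - dispersion r t)⁻¹

lemma one_div_sq_le_sub_dispersion (r : ℕ) (σ t : ℝ) :
    1 / σ ^ 2 ≤ 1 / σ ^ 2 + 1 - dispersion r t := by
  linarith [(abs_le.1 (abs_dispersion_le r t)).2]

lemma profile_pos (r : ℕ) {σ : ℝ} (hσ : 0 < σ) (t : ℝ) : 0 < profile r σ t :=
  inv_pos.2 ((by positivity : 0 < 1 / σ ^ 2).trans_le (one_div_sq_le_sub_dispersion r σ t))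

lemma profile_le (r : ℕ) {σ : ℝ} (hσ : 0 < σ) (t : ℝ) : profile r σ t ≤ σ ^ 2 := by
  have := inv_anti₀ (by positivity) (one_div_sq_le_sub_dispersion r σ t)
  simpa [profile] using this

lemma le_profile (r : ℕ) {σ : ℝ} (hσ : 0 < σ) (t : ℝ) :
    1 / (1 / σ ^ 2 + 2) ≤ profile r σ t := by
  rw [one_div]
  refine inv_anti₀ ((by positivity : 0 < 1 / σ ^ 2).trans_le
    (one_div_sq_le_sub_dispersion r σ t)) ?_
  linarith [(abs_le.1 (abs_dispersion_le r t)).1]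

lemma profile_zero {r : ℕ} (hr : 1 ≤ r) (σ : ℝ) : profile r σ 0 = σ ^ 2 := by
  simp [profile, dispersion_zero hr]

lemma abs_profile_sub_le (r : ℕ) {σ : ℝ} (hσ : 0 < σ) (x y : ℝ) :
    |profile r σ x - profile r σ y| ≤ σ ^ 4 * (2 * π * r) * |x - y| := by
  have hx := profile_pos r hσ x
  have hy := profile_pos r hσ y
  have hx0 := (inv_pos.1 hx).ne'
  have hy0 := (inv_pos.1 hy).ne'
  have e : profile r σ x - profile r σ y =
      profile r σ x * profile r σ y * (dispersion r x - dispersion r y) := by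
    unfold profile
    rw [inv_sub_inv hx0 hy0]
    field_simp
    ring
  rw [e, abs_mul, abs_of_pos (mul_pos hx hy)]
  calc _ ≤ σ ^ 2 * σ ^ 2 * (2 * π * r * |x - y|) := by
        gcongr
        · exact profile_le r hσ x
        · exact profile_le r hσ y
        · exact abs_dispersion_sub_le r x y
    _ = _ := by ring

lemma map_μmeas {n r : ℕ} [NeZero n] {s : ℝ} {a : Fin n → ℝ} (ha : ∀ k, 0 < a k)
    (has : ∀ k : Fin n, dispersion r ((k : ℕ) / n) * a k = s * a k - 1) :
    (μmeas n r).map (fun x => Mag n x / √(n : ℝ)) =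
      (ENNReal.ofReal (∫ g, gibbsWeight a g ∂(Measure.pi fun _ : Fin n => gaussianReal 0 1)))⁻¹ •
        ((Measure.pi fun _ : Fin n => gaussianReal 0 1).withDensity
          fun g => ENNReal.ofReal (gibbsWeight a g)).map
          fun g => √(normRatio a g) * (√(a 0) * g 0) := by
  obtain ⟨C, hC0, hC, h⟩ := exists_lintegral_preμ ha has
  have hW := (measurable_gibbsWeight a).ennreal_ofReal
  have hT : Measurable fun g : Fin n → ℝ => √(normRatio a g) * (√(a 0) * g 0) :=
    (measurable_normRatio a).sqrt.mul ((measurable_pi_apply 0).const_mul _)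
  have h1 := h (fun _ => 1) measurable_const
  simp only [lintegral_one, mul_one] at h1
  rw [← ofReal_integral_eq_lintegral_ofReal (integrable_gibbsWeight ha)
    (ae_of_all _ fun g => (gibbsWeight_pos a g).le)] at h1
  refine Measure.ext_of_lintegral _ fun f hf => ?_
  have hfT : Measurable fun g : Fin n → ℝ => f (√(normRatio a g) * (√(a 0) * g 0)) := hf.comp hT
  rw [lintegral_map hf ((measurable_Mag n).div_const _), μmeas, lintegral_smul_measure, h f hf, h1,
    lintegral_smul_measure, lintegral_map hf hT,
    lintegral_withDensity_eq_lintegral_mul _ hW hfT, smul_eq_mul, smul_eq_mul,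
    ENNReal.mul_inv (Or.inl hC0) (Or.inl hC), mul_comm C⁻¹, mul_assoc, ← mul_assoc C⁻¹,
    ENNReal.inv_mul_cancel hC0 hC, one_mul]
  rfl

lemma integral_gibbsWeight_pos {n : ℕ} [NeZero n] {a : Fin n → ℝ} (ha : ∀ k, 0 < a k) :
    0 < ∫ g, gibbsWeight a g ∂(Measure.pi fun _ : Fin n => gaussianReal 0 1) := by
  rw [integral_pos_iff_support_of_nonneg (fun g => (gibbsWeight_pos a g).le)
    (integrable_gibbsWeight ha)]
  have : Function.support (gibbsWeight a) = Set.univ :=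
    Set.eq_univ_of_forall fun g => (gibbsWeight_pos a g).ne'
  simp [this]

lemma isProbabilityMeasure_map_μmeas {n r : ℕ} [NeZero n] {s : ℝ} {a : Fin n → ℝ}
    (ha : ∀ k, 0 < a k) (has : ∀ k : Fin n, dispersion r ((k : ℕ) / n) * a k = s * a k - 1) :
    IsProbabilityMeasure ((μmeas n r).map fun x => Mag n x / √(n : ℝ)) := by
  have hT : Measurable fun g : Fin n → ℝ => √(normRatio a g) * (√(a 0) * g 0) :=
    (measurable_normRatio a).sqrt.mul ((measurable_pi_apply 0).const_mul _)
  refine ⟨?_⟩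
  rw [map_μmeas ha has, Measure.smul_apply, Measure.map_apply hT MeasurableSet.univ,
    Set.preimage_univ, withDensity_apply _ MeasurableSet.univ, Measure.restrict_univ,
    ← ofReal_integral_eq_lintegral_ofReal (integrable_gibbsWeight ha)
      (ae_of_all _ fun g => (gibbsWeight_pos a g).le), smul_eq_mul]
  exact ENNReal.inv_mul_cancel (ENNReal.ofReal_pos.2 (integral_gibbsWeight_pos ha)).ne'
    ENNReal.ofReal_ne_top

lemma integral_map_μmeas {n r : ℕ} [NeZero n] {s : ℝ} {a : Fin n → ℝ} (ha : ∀ k, 0 < a k)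
    (has : ∀ k : Fin n, dispersion r ((k : ℕ) / n) * a k = s * a k - 1)
    {f : ℝ → ℝ} (hf : Measurable f) :
    ∫ y, f y ∂((μmeas n r).map fun x => Mag n x / √(n : ℝ)) =
      (∫ g : Fin n → ℝ, f (√(normRatio a g) * (√(a 0) * g 0)) * gibbsWeight a g
        ∂(Measure.pi fun _ : Fin n => gaussianReal 0 1)) /
      ∫ g, gibbsWeight a g ∂(Measure.pi fun _ : Fin n => gaussianReal 0 1) := by
  have hT : Measurable fun g : Fin n → ℝ => √(normRatio a g) * (√(a 0) * g 0) :=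
    (measurable_normRatio a).sqrt.mul ((measurable_pi_apply 0).const_mul _)
  rw [map_μmeas ha has, integral_smul_measure, integral_map hT.aemeasurable
    hf.aestronglyMeasurable, integral_withDensity_eq_integral_toReal_smul
    (measurable_gibbsWeight a).ennreal_ofReal (ae_of_all _ fun g => ENNReal.ofReal_lt_top),
    ENNReal.toReal_inv, ENNReal.toReal_ofReal (integral_gibbsWeight_pos ha).le, smul_eq_mul,
    inv_mul_eq_div]
  congr 1
  refine integral_congr_ae (ae_of_all _ fun g => ?_)
  simp only [ENNReal.toReal_ofReal (gibbsWeight_pos a g).le, smul_eq_mul, mul_comm]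

lemma integral_comp_mul_eval_zero {n : ℕ} [NeZero n] {c : ℝ} (hc : 0 ≤ c) {f : ℝ → ℝ}
    (hf : Measurable f) :
    ∫ g : Fin n → ℝ, f (√c * g 0) ∂(Measure.pi fun _ : Fin n => gaussianReal 0 1) =
      ∫ y, f y ∂(gaussianReal 0 c.toNNReal) := by
  have h1 : (gaussianReal 0 1).map (√c * ·) = gaussianReal 0 c.toNNReal := by
    rw [gaussianReal_map_const_mul, mul_zero, mul_one]
    congr 1
    ext
    simp [Real.sq_sqrt hc, hc]
  rw [integral_comp_eval (X := fun _ : Fin n => ℝ) (μ := fun _ : Fin n => gaussianReal 0 1)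
    (f := fun t : ℝ => f (√c * t)) (hf.comp (measurable_const_mul _)).aestronglyMeasurable,
    ← h1, integral_map (by fun_prop) hf.aestronglyMeasurable]

lemma dispersion_mul_profile (r : ℕ) {σ : ℝ} (hσ : 0 < σ) (t : ℝ) :
    dispersion r t * profile r σ t = (1 / σ ^ 2 + 1) * profile r σ t - 1 := by
  have h := mul_inv_cancel₀ (inv_pos.1 (profile_pos r hσ t)).ne'
  unfold profile
  linarith

/-- Quantitative version of the limit theorem, for bounded Lipschitz test functions. -/
lemma exists_abs_integral_map_μmeas_sub_le {r : ℕ} (hr : 1 ≤ r) {σ : ℝ} (hσ : 0 < σ)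
    (hint : ∫ t in (0 : ℝ)..1, profile r σ t = 1) {L M : ℝ} {f : ℝ → ℝ} (hf : Measurable f)
    (hL : 0 ≤ L) (hfL : ∀ x y, |f x - f y| ≤ L * |x - y|) (hfM : ∀ x, |f x| ≤ M) :
    ∃ C : ℝ, ∀ (n : ℕ) [NeZero n],
      |∫ y, f y ∂((μmeas n r).map fun x => Mag n x / √(n : ℝ)) -
        ∫ y, f y ∂(gaussianReal 0 (σ ^ 2).toNNReal)| ≤ C / √(n : ℝ) := by
  set K := σ ^ 2 + 1 / σ ^ 2 + 2 with hKdef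
  have hσ2 : 0 < σ ^ 2 := by positivity
  have hσ2' : 0 < 1 / σ ^ 2 := by positivity
  have hK : 1 ≤ K := by linarith
  have hM : 0 ≤ M := (abs_nonneg _).trans (hfM 0)
  obtain ⟨m, hm0, hm⟩ := exists_integral_errorTerm_le K (σ ^ 4 * (2 * π * r))
  refine ⟨(4 * L * K ^ 3 + 20 * M * K ^ 7) * m / rexp (-(2 * K ^ 3 * m)), fun n _ => ?_⟩
  set a : Fin n → ℝ := fun k => profile r σ ((k : ℕ) / n) with ha_def
  have ha : ∀ k, 0 < a k := fun k => profile_pos r hσ _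
  have has : ∀ k : Fin n, dispersion r ((k : ℕ) / n) * a k = (1 / σ ^ 2 + 1) * a k - 1 :=
    fun k => dispersion_mul_profile r hσ _
  have haK : ∀ k, 1 / K ≤ a k := fun k =>
    (one_div_le_one_div_of_le (by positivity) (by linarith)).trans (le_profile r hσ _)
  have hKa : ∀ k, a k ≤ K := fun k => (profile_le r hσ _).trans (by linarith)
  have ha0 : a 0 = σ ^ 2 := by
    simp [ha_def, profile_zero hr]
  have hdev : ∀ k, |1 - a k| ≤ K := fun k => by
    rw [abs_le]
    constructor <;> linarith [hKa k, ha k]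
  have hsum : |∑ k, (1 - a k)| ≤ σ ^ 4 * (2 * π * r) := by
    have := abs_sum_sub_mul_integral_le (abs_profile_sub_le r hσ) (by positivity) n
    rw [hint, mul_one] at this
    rw [Finset.sum_sub_distrib, abs_sub_comm]
    simpa using this
  obtain ⟨i1, b1, i2, b2⟩ := hm n a hdev hsum
  have hlow := exp_neg_le_integral_gibbsWeight hK haK hKa i1 b1
  have hcmp := abs_integral_mul_gibbsWeight_sub_le hK haK hKa i2 hf hL hfL hfM
  rw [integral_comp_mul_eval_zero (ha 0).le hf, ha0] at hcmp
  rw [integral_map_μmeas ha has hf, ha0]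
  have hpos := integral_gibbsWeight_pos ha
  set A := ∫ g, gibbsWeight a g ∂(Measure.pi fun _ : Fin n => gaussianReal 0 1)
  rw [div_sub' hpos.ne', abs_div, abs_of_pos hpos, mul_comm A]
  calc _ ≤ (4 * L * K ^ 3 + 20 * M * K ^ 7) * (m / √(n : ℝ)) / A := by
        gcongr
        exact hcmp.trans (by gcongr)
    _ ≤ (4 * L * K ^ 3 + 20 * M * K ^ 7) * (m / √(n : ℝ)) / rexp (-(2 * K ^ 3 * m)) := by gcongr
    _ = _ := by ring

/-- **Theorem (finite range case).** For a constant interaction range `r ≥ 1`, under `μ_n`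
the rescaled magnetization `S_n / √n` converges in distribution to the centered Gaussian
law `N(0, σ_r²)`, where `σ_r > 0` satisfies
`∫_0^1 (1/σ_r² + 1 - (1/r) ∑_{m=1}^r cos(2πmt))⁻¹ dt = 1`. -/
theorem finite_range_gaussian_fluctuations
    (r : ℕ) (hr : 1 ≤ r) (σ : ℝ) (hσ : 0 < σ)
    (hchar : ∫ t in (0:ℝ)..1,
        (1 / σ ^ 2 + 1 - (1 / (r : ℝ)) * ∑ m ∈ Finset.Icc 1 r, Real.cos (2 * π * m * t))⁻¹ = 1) :
    ∀ φ : BoundedContinuousFunction ℝ ℝ,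
      Tendsto (fun n : ℕ => ∫ x, φ (Mag n x / Real.sqrt n) ∂(μmeas n r)) atTop
        (𝓝 (∫ x, φ x ∂(gaussianReal 0 (Real.toNNReal (σ ^ 2))))) := by
  have hint : ∫ t in (0 : ℝ)..1, profile r σ t = 1 := hchar
  let μs : ℕ → ProbabilityMeasure ℝ := fun n =>
    ⟨(μmeas (n + 1) r).map fun x => Mag (n + 1) x / √((n + 1 : ℕ) : ℝ),
      isProbabilityMeasure_map_μmeas (a := fun k => profile r σ ((k : ℕ) / (n + 1 : ℕ)))
        (fun k => profile_pos r hσ _) fun k => dispersion_mul_profile r hσ _⟩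
  let μ : ProbabilityMeasure ℝ := ⟨gaussianReal 0 (σ ^ 2).toNNReal, inferInstance⟩
  have key : Tendsto μs atTop (𝓝 μ) := by
    refine tendsto_iff_forall_lipschitz_integral_tendsto.2 ?_
    rintro f ⟨B, hB⟩ ⟨L, hL⟩
    have hfM : ∀ x, |f x| ≤ |f 0| + B := fun x => by
      have h1 := hB x 0
      rw [Real.dist_eq] at h1
      linarith [abs_sub_abs_le_abs_sub (f x) (f 0)]
    obtain ⟨C, hC⟩ := exists_abs_integral_map_μmeas_sub_le hr hσ hint hL.continuous.measurable
      L.coe_nonneg (fun x y => by simpa [Real.dist_eq] using hL.dist_le_mul x y) hfM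
    rw [tendsto_iff_norm_sub_tendsto_zero]
    have hlim : Tendsto (fun n : ℕ => C / √((n + 1 : ℕ) : ℝ)) atTop (𝓝 0) :=
      ((Real.tendsto_sqrt_atTop.comp tendsto_natCast_atTop_atTop).const_div_atTop C).comp
        (tendsto_add_atTop_nat 1)
    exact squeeze_zero (fun _ => norm_nonneg _) (fun n => hC (n + 1)) hlim
  intro φ
  rw [← tendsto_add_atTop_iff_nat 1]
  refine (ProbabilityMeasure.tendsto_iff_forall_integral_tendsto.1 key φ).congr fun n => ?_
  exact integral_map ((measurable_Mag _).div_const _).aemeasurable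
    φ.continuous.measurable.aestronglyMeasurable

end
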